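/- arXiv:1507.07604 — 2 statements merged into one kernel-verified Lean document; each statement's English description precedes it below -/
import Mathlib

section
/- Let p: X → B be a morphism of smooth affine algebraic varieties which is a Zariski locally trivial 𝔸¹-fibration, where X carries an algebraic volume form ω, dim X = n, dim B = n − 1, and Θ: AVF(X) → Ω^{n−1}(X) is the isomorphism ξ ↦ ι_ξ ω. Then every class in H^{n−1}(X, ℂ) is represented by a closed algebraic (n−1)-form τ such that Θ^{-1}(τ) is a locally nilpotent vector field tangent to the fibers of p. -/
/-!
STATEMENT 10 (Proposition `B1`): Let p : X → B be a morphism of smooth affine algebraic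
varieties which is a Zariski locally trivial 𝔸¹-fibration, where X carries an algebraic
volume form ω, dim X = n, dim B = n − 1, and Θ : AVF(X) → Ω^{n−1}(X) is the isomorphism
ξ ↦ ι_ξ ω.  Then every class in H^{n−1}(X, ℂ) is represented by a closed algebraic
(n−1)-form τ such that Θ⁻¹(τ) is a locally nilpotent vector field tangent to the fibers
of p.

Modelling conventions: X and B are given by coordinate rings `A` and `R`, the morphism p
by the comorphism `πs : R →ₐ[ℂ] A`.  Zariski local triviality: there are α_i ∈ ℂ[B]
without common zeros such that the localization `A[1/πs(α_i)]` is isomorphic over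
`B_i = {α_i ≠ 0}` to the polynomial ring `R[1/α_i][t]`.  Algebraic (n−2)-, (n−1)- and
n-forms, the exterior differential d, the interior product ι and the volume form are
bundled in `VolumeForms` (with `Θ(ξ) = ι_ξ ω` a bijection onto (n−1)-forms).  Since X is
smooth affine, H^{n−1}(X, ℂ) is computed by the algebraic de Rham complex (Grothendieck),
i.e. it is the quotient of the closed algebraic (n−1)-forms by the exact ones; a vector
field ν is tangent to the fibers of p iff ν kills the pullback of ℂ[B].
-/

noncomputable section

def IsLND {A : Type*} [CommRing A] [Algebra ℂ A] (ξ : Derivation ℂ A A) : Prop :=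
  ∀ a : A, ∃ N : ℕ, (ξ.toLinearMap ^ N) a = 0

/-- Differential-form data for a smooth affine variety `X` of dimension `n` with
coordinate ring `A`: the modules `F0, F1, F2` of algebraic forms of degrees
`n-2, n-1, n`, the exterior differential, the interior products with algebraic vector
fields, a nowhere vanishing top form `vol` (algebraic volume form), and the induced
action ("pullback") of algebra automorphisms on forms. -/
structure VolumeForms (A : Type*) [CommRing A] [Algebra ℂ A] where
  F0 : Type*
  F1 : Type*
  F2 : Type*
  [acg0 : AddCommGroup F0]
  [acg1 : AddCommGroup F1]
  [acg2 : AddCommGroup F2]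
  [modA0 : Module A F0]
  [modA1 : Module A F1]
  [modA2 : Module A F2]
  [modC0 : Module ℂ F0]
  [modC1 : Module ℂ F1]
  [modC2 : Module ℂ F2]
  [tower0 : IsScalarTower ℂ A F0]
  [tower1 : IsScalarTower ℂ A F1]
  [tower2 : IsScalarTower ℂ A F2]
  /-- exterior differential on (n-2)-forms -/
  d0 : F0 →ₗ[ℂ] F1
  /-- exterior differential on (n-1)-forms -/
  d1 : F1 →ₗ[ℂ] F2
  dd : ∀ τ : F0, d1 (d0 τ) = 0
  /-- interior product of a vector field with an n-form -/
  ι2 : Derivation ℂ A A →ₗ[A] (F2 →ₗ[A] F1)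
  /-- interior product of a vector field with an (n-1)-form -/
  ι1 : Derivation ℂ A A →ₗ[A] (F1 →ₗ[A] F0)
  /-- the algebraic volume form -/
  vol : F2
  /-- `vol` is nowhere vanishing: it freely generates the top forms -/
  vol_basis : Function.Bijective fun a : A => a • vol
  /-- `Θ : ξ ↦ ι_ξ ω` is an isomorphism of vector fields onto (n-1)-forms -/
  theta_bij : Function.Bijective fun ξ : Derivation ℂ A A => ι2 ξ vol
  /-- `ι_{[σ,δ]} ω = d (ι_σ ι_δ ω)` for divergence-free σ, δ -/
  cartan : ∀ σ δ : Derivation ℂ A A, d1 (ι2 σ vol) = 0 → d1 (ι2 δ vol) = 0 →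
    ι2 ⁅σ, δ⁆ vol = d0 (ι1 σ (ι2 δ vol))
  /-- functorial action of algebra automorphisms on (n-2)-forms -/
  push0 : (A ≃ₐ[ℂ] A) → (F0 →+ F0)
  push1 : (A ≃ₐ[ℂ] A) → (F1 →+ F1)
  push2 : (A ≃ₐ[ℂ] A) → (F2 →+ F2)
  push0_smul : ∀ (g : A ≃ₐ[ℂ] A) (a : A) (τ : F0), push0 g (a • τ) = g a • push0 g τ
  push1_smul : ∀ (g : A ≃ₐ[ℂ] A) (a : A) (τ : F1), push1 g (a • τ) = g a • push1 g τ
  push2_smul : ∀ (g : A ≃ₐ[ℂ] A) (a : A) (τ : F2), push2 g (a • τ) = g a • push2 g τ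
  push0_one : push0 1 = AddMonoidHom.id F0
  push1_one : push1 1 = AddMonoidHom.id F1
  push2_one : push2 1 = AddMonoidHom.id F2
  push0_mul : ∀ g h τ, push0 (g * h) τ = push0 g (push0 h τ)
  push1_mul : ∀ g h τ, push1 (g * h) τ = push1 g (push1 h τ)
  push2_mul : ∀ g h τ, push2 (g * h) τ = push2 g (push2 h τ)
  push_d0 : ∀ g τ, d0 (push0 g τ) = push1 g (d0 τ)
  push_d1 : ∀ g τ, d1 (push1 g τ) = push2 g (d1 τ)
  push_ι2 : ∀ (g : A ≃ₐ[ℂ] A) (ξ : Derivation ℂ A A) (τ : F2),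
    (∀ a, ξ (g a) = g (ξ a)) → push1 g (ι2 ξ τ) = ι2 ξ (push2 g τ)
  push_ι1 : ∀ (g : A ≃ₐ[ℂ] A) (ξ : Derivation ℂ A A) (τ : F1),
    (∀ a, ξ (g a) = g (ξ a)) → push0 g (ι1 ξ τ) = ι1 ξ (push1 g τ)

attribute [instance] VolumeForms.acg0 VolumeForms.acg1 VolumeForms.acg2
  VolumeForms.modA0 VolumeForms.modA1 VolumeForms.modA2
  VolumeForms.modC0 VolumeForms.modC1 VolumeForms.modC2
  VolumeForms.tower0 VolumeForms.tower1 VolumeForms.tower2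


/-- A vector field is divergence-free (has zero divergence w.r.t. the volume form)
iff `ι_ξ ω` is closed (equivalently `L_ξ ω = d ι_ξ ω = 0`). -/
def VolumeForms.DivFree {A : Type*} [CommRing A] [Algebra ℂ A] (Ω : VolumeForms A)
    (ξ : Derivation ℂ A A) : Prop :=
  Ω.d1 (Ω.ι2 ξ Ω.vol) = 0

section

open Polynomial

/-- An embedding of `A` as a subring of `F[X]` carrying enough elements `f i = u i * X` and
derivations `ν i = v i * d/dX` for `X * d/dX` to be `∑ i, f i • ν i`. -/
structure AffineFrame (A : Type*) [CommRing A] [Algebra ℂ A] (F : Type*) [Field F] [Algebra ℂ F]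
    (k : ℕ) where
  j : A →ₐ[ℂ] F[X]
  j_injective : Function.Injective j
  f : Fin k → A
  ν : Fin k → Derivation ℂ A A
  u : Fin k → F
  v : Fin k → F
  j_f : ∀ i, j (f i) = C (u i) * X
  j_ν : ∀ i a, j (ν i a) = C (v i) * derivative (j a)
  sum_uv : ∑ i, u i * v i = 1

namespace AffineFrame

variable {A : Type*} [CommRing A] [Algebra ℂ A] {F : Type*} [Field F] [Algebra ℂ F]
  {k : ℕ} (S : AffineFrame A F k)

/-- The Euler vector field `X * d/dX`. -/
def euler : Derivation ℂ A A := ∑ i, S.f i • S.ν i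

lemma euler_apply (a : A) : S.euler a = ∑ i, S.f i * S.ν i a := by
  simp only [euler, ← Derivation.coeFnAddMonoidHom_apply, map_sum, Finset.sum_apply]
  rfl

lemma j_euler (a : A) : S.j (S.euler a) = X * derivative (S.j a) := by
  rw [euler_apply, map_sum]
  calc ∑ i, S.j (S.f i * S.ν i a) = ∑ i, C (S.u i * S.v i) * (X * derivative (S.j a)) := by
        refine Finset.sum_congr rfl fun i _ => ?_
        rw [map_mul, S.j_f, S.j_ν, C_mul]; ring
    _ = _ := by rw [← Finset.sum_mul, ← map_sum, S.sum_uv, map_one, one_mul]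

/-- Homogeneous elements of degree `m`. -/
def IsHom (m : ℤ) (a : A) : Prop := S.euler a = (m : A) * a

/-- Homogeneous derivations of degree `m`. -/
def IsHomDer (m : ℤ) (ξ : Derivation ℂ A A) : Prop :=
  ∀ a, S.euler (ξ a) = ξ (S.euler a) + (m : A) * ξ a

lemma coeff_X_mul_derivative (p : F[X]) (n : ℕ) : (X * derivative p).coeff n = n * p.coeff n := by
  cases n with
  | zero => simp
  | succ n => rw [coeff_X_mul, coeff_derivative]; push_cast; ring

lemma isHom_iff [CharZero F] {m : ℤ} {a : A} :
    S.IsHom m a ↔ ∀ n : ℕ, (n : ℤ) ≠ m → (S.j a).coeff n = 0 := by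
  have h1 : S.IsHom m a ↔ X * derivative (S.j a) = C (m : F) * S.j a := by
    rw [IsHom, ← S.j_injective.eq_iff, j_euler, map_mul, map_intCast]
    simp
  rw [h1, Polynomial.ext_iff]
  refine forall_congr' fun n => ?_
  rw [coeff_X_mul_derivative, coeff_C_mul]
  constructor
  · intro h hn
    have : ((n : F) - (m : F)) * (S.j a).coeff n = 0 := by linear_combination h
    rcases mul_eq_zero.1 this with h' | h'
    · exact absurd (by exact_mod_cast sub_eq_zero.1 h') hn
    · exact h'
  · intro h
    by_cases hn : (n : ℤ) = m
    · subst hn; simp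
    · simp [h hn]

lemma IsHom.j_eq [CharZero F] {m : ℕ} {a : A} (h : S.IsHom m a) :
    S.j a = monomial m ((S.j a).coeff m) := by
  ext n
  rw [coeff_monomial]
  split_ifs with hn
  · rw [hn]
  · exact S.isHom_iff.1 h n (by omega)

lemma isHom_of_j_eq [CharZero F] {m : ℕ} {a : A} {c : F} (h : S.j a = monomial m c) :
    S.IsHom m a := by
  rw [isHom_iff]
  intro n hn
  rw [h, coeff_monomial, if_neg]
  exact_mod_cast hn.symm

lemma IsHom.eq_zero [CharZero F] {m : ℤ} {a : A} (h : S.IsHom m a) (hm : m < 0) : a = 0 := by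
  apply S.j_injective
  rw [map_zero]
  ext n
  exact S.isHom_iff.1 h n (by omega)

variable {S}

lemma IsHom.add {m : ℤ} {a b : A} (ha : S.IsHom m a) (hb : S.IsHom m b) : S.IsHom m (a + b) := by
  unfold IsHom at *; rw [map_add, ha, hb]; ring

lemma IsHom.sub {m : ℤ} {a b : A} (ha : S.IsHom m a) (hb : S.IsHom m b) : S.IsHom m (a - b) := by
  unfold IsHom at *; rw [map_sub, ha, hb]; ring

lemma IsHom.mul {m n : ℤ} {a b : A} (ha : S.IsHom m a) (hb : S.IsHom n b) :
    S.IsHom (m + n) (a * b) := by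
  unfold IsHom at *; rw [Derivation.leibniz, ha, hb]; push_cast; simp only [smul_eq_mul]; ring

lemma IsHomDer.apply {m n : ℤ} {ξ : Derivation ℂ A A} {a : A} (hξ : S.IsHomDer m ξ)
    (ha : S.IsHom n a) : S.IsHom (m + n) (ξ a) := by
  unfold IsHom at *
  rw [hξ, ha, Derivation.leibniz]
  simp only [smul_eq_mul, Derivation.map_intCast]; push_cast; ring

lemma IsHomDer.smul {m n : ℤ} {ξ : Derivation ℂ A A} {a : A} (ha : S.IsHom n a)
    (hξ : S.IsHomDer m ξ) : S.IsHomDer (n + m) (a • ξ) := by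
  intro b
  unfold IsHom at ha
  simp only [Derivation.smul_apply, smul_eq_mul, Derivation.leibniz, ha, hξ b]
  push_cast; ring

lemma IsHomDer.sub {m : ℤ} {ξ η : Derivation ℂ A A} (hξ : S.IsHomDer m ξ) (hη : S.IsHomDer m η) :
    S.IsHomDer m (ξ - η) := by
  intro b
  simp only [Derivation.sub_apply, map_sub, hξ b, hη b]; ring

lemma IsHomDer.lie {m n : ℤ} {ξ η : Derivation ℂ A A} (hξ : S.IsHomDer m ξ)
    (hη : S.IsHomDer n η) : S.IsHomDer (m + n) ⁅ξ, η⁆ := by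
  intro b
  simp only [Derivation.commutator_apply, map_sub, hξ _, hη _, map_add, Derivation.leibniz,
    Derivation.map_intCast, smul_eq_mul]
  push_cast; ring

variable (S)

lemma isHomDer_euler : S.IsHomDer 0 S.euler := fun a => by simp

lemma isHom_f [CharZero F] (i : Fin k) : S.IsHom 1 (S.f i) :=
  S.isHom_of_j_eq (m := 1) (c := S.u i) (by rw [S.j_f, C_mul_X_eq_monomial])

lemma isHomDer_ν (i : Fin k) : S.IsHomDer (-1) (S.ν i) := by
  intro a
  apply S.j_injective
  rw [map_add, map_mul, map_intCast, j_euler, S.j_ν, S.j_ν, j_euler, derivative_C_mul,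
    derivative_mul, derivative_X]
  push_cast; ring

lemma sum_ν_f : ∑ i, S.ν i (S.f i) = 1 := by
  apply S.j_injective
  rw [map_sum, map_one, ← C_1, ← S.sum_uv, map_sum]
  refine Finset.sum_congr rfl fun i _ => ?_
  rw [S.j_ν, S.j_f, derivative_C_mul, derivative_X, mul_one, ← C_mul, mul_comm]

lemma exists_component [CharZero F] (a : A) (n : ℕ) :
    ∃ b, S.j b = monomial n ((S.j a).coeff n) := by
  induction hs : (S.j a).support.card using Nat.strong_induction_on generalizing a with
  | _ s ih =>
  by_cases h : ∃ i ∈ (S.j a).support, i ≠ n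
  · obtain ⟨i, hi, hin⟩ := h
    have hc : ∀ m, (S.j (S.euler a - (i : A) * a)).coeff m = ((m : F) - i) * (S.j a).coeff m := by
      intro m
      rw [map_sub, map_mul, map_natCast, j_euler, coeff_sub, coeff_X_mul_derivative,
        ← C_eq_natCast, coeff_C_mul]; ring
    have hlt : (S.j (S.euler a - (i : A) * a)).support.card < s := by
      rw [← hs]
      apply Finset.card_lt_card
      refine (Finset.ssubset_iff_of_subset ?_).2 ⟨i, hi, ?_⟩
      · intro m hm
        rw [mem_support_iff, hc] at hm
        exact mem_support_iff.2 (right_ne_zero_of_mul hm)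
      · rw [notMem_support_iff, hc, sub_self, zero_mul]
    obtain ⟨b, hb⟩ := ih _ hlt _ rfl
    have hne : (n : ℂ) - i ≠ 0 := sub_ne_zero.2 (by exact_mod_cast hin.symm)
    refine ⟨((n : ℂ) - i)⁻¹ • b, ?_⟩
    have hm : algebraMap ℂ F ((n : ℂ) - i) = (n : F) - i := by simp
    rw [map_smul, hb, hc, ← hm, ← Algebra.smul_def, ← smul_monomial, smul_smul,
      inv_mul_cancel₀ hne, one_smul]
  · push Not at h
    refine ⟨a, ?_⟩
    ext m
    rw [coeff_monomial]
    split_ifs with hm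
    · rw [hm]
    · by_contra hne
      exact hm (h m (mem_support_iff.2 hne)).symm

@[elab_as_elim]
lemma hom_induction [CharZero F] {P : A → Prop} (zero : P 0) (add : ∀ a b, P a → P b → P (a + b))
    (hom : ∀ (n : ℕ) (a : A), S.IsHom n a → P a) (a : A) : P a := by
  choose b hb using S.exists_component a
  have : a = ∑ n ∈ (S.j a).support, b n := by
    apply S.j_injective
    conv_lhs => rw [(S.j a).as_sum_support]
    rw [map_sum]
    exact Finset.sum_congr rfl fun n _ => (hb n).symm
  rw [this]
  exact Finset.sum_induction _ _ add zero fun n _ => hom n _ (S.isHom_of_j_eq (hb n))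

lemma exists_uv_ne_zero : ∃ i, S.u i ≠ 0 ∧ S.v i ≠ 0 := by
  by_contra! h
  have : ∑ i, S.u i * S.v i = 0 := Finset.sum_eq_zero fun i _ => by
    by_cases hu : S.u i = 0
    · simp [hu]
    · simp [h i hu]
  exact one_ne_zero (S.sum_uv.symm.trans this)

/-- A derivation killing degree zero elements is a multiple of `d/dX`. -/
lemma exists_j_eq_mul_derivative [CharZero F] (η : Derivation ℂ A A)
    (h : ∀ a, S.IsHom 0 a → η a = 0) : ∃ p : F[X], (∀ a, S.j (η a) = p * derivative (S.j a)) ∧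
      ∀ m : ℤ, S.IsHomDer m η → ∀ n : ℕ, (n : ℤ) ≠ m + 1 → p.coeff n = 0 := by
  obtain ⟨i, hu, hv⟩ := S.exists_uv_ne_zero
  refine ⟨C (S.u i)⁻¹ * S.j (η (S.f i)), fun a => ?_, fun m hm n hn => ?_⟩
  · induction a using S.hom_induction with
    | zero => simp
    | add a b ha hb => simp only [map_add, ha, hb, mul_add]
    | hom n a ha =>
      set c := (S.j a).coeff n with hc
      have hja : S.j a = C c * X ^ n := by rw [C_mul_X_pow_eq_monomial]; exact IsHom.j_eq S ha
      have hpow : ∀ l : ℕ, S.j ((S.ν i)^[l] a) = C (S.v i) ^ l * derivative^[l] (S.j a) := by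
        intro l
        induction l with
        | zero => simp
        | succ l ih =>
          rw [Function.iterate_succ_apply', Function.iterate_succ_apply', S.j_ν, ih,
            ← C_pow, derivative_C_mul]; simp only [C_pow]; ring
      have hb : S.j ((S.ν i)^[n] a) = C (S.v i ^ n * c * n.factorial) := by
        rw [hpow, hja, iterate_derivative_C_mul, iterate_derivative_X_pow_eq_natCast_mul,
          Nat.descFactorial_self, Nat.sub_self, pow_zero, mul_one, ← C_eq_natCast]
        simp only [C_mul, C_pow]; ring
      set b := (S.ν i)^[n] a with hbdef
      have hb0 : S.IsHom 0 b := S.isHom_of_j_eq (m := 0) hb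
      have hjd : S.j (S.ν i (S.f i)) = C (S.u i * S.v i) := by
        rw [S.j_ν, S.j_f, derivative_C_mul, derivative_X, mul_one, ← C_mul, mul_comm]
      have hd0 : S.IsHom 0 (S.ν i (S.f i)) := S.isHom_of_j_eq (m := 0) hjd
      have key : (n.factorial : A) * (S.ν i (S.f i)) ^ n * a = b * S.f i ^ n := by
        apply S.j_injective
        rw [map_mul, map_mul, map_pow, map_natCast, map_mul, map_pow, hjd, hb, S.j_f, hja,
          ← C_eq_natCast]
        simp only [C_mul, C_pow, mul_pow]; ring
      have hd0' : η (S.ν i (S.f i)) = 0 := h _ hd0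
      have key2 := congrArg η key
      simp only [Derivation.leibniz, Derivation.leibniz_pow, hd0', h b hb0, smul_eq_mul,
        Derivation.map_natCast, mul_zero, smul_zero, add_zero, zero_add, nsmul_eq_mul] at key2
      have key3 := congrArg S.j key2
      rw [map_mul, map_mul, map_pow, map_natCast, map_mul, map_mul, map_mul, map_natCast, map_pow,
        hjd, hb, S.j_f] at key3
      rw [hja, derivative_C_mul, derivative_X_pow]
      have hne : (n.factorial : F[X]) * C (S.u i * S.v i) ^ n ≠ 0 := by
        refine mul_ne_zero (by exact_mod_cast n.factorial_ne_zero) (pow_ne_zero _ ?_)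
        simp [hu, hv]
      apply mul_left_cancel₀ hne
      rw [key3]
      have hui : C (S.u i)⁻¹ * C (S.u i) = 1 := by rw [← C_mul, inv_mul_cancel₀ hu, C_1]
      rcases n with _ | n
      · simp
      · simp only [C_mul, C_pow, C_eq_natCast, Nat.add_sub_cancel, mul_pow, pow_succ]
        linear_combination (-(C (S.v i) ^ n * C (S.v i) * C c * ((n+1).factorial : F[X]) *
          ((n+1 : ℕ) : F[X]) * C (S.u i) ^ n * X ^ n * S.j (η (S.f i)))) * hui
  · rw [coeff_C_mul]
    rw [S.isHom_iff.1 (hm.apply (S.isHom_f i)) n hn, mul_zero]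

lemma IsHomDer.apply_zero [CharZero F] {m : ℤ} {ξ : Derivation ℂ A A} (hξ : S.IsHomDer m ξ)
    (hm : m < 0) {a : A} (ha : S.IsHom 0 a) : ξ a = 0 :=
  (hξ.apply ha).eq_zero S (by omega)

lemma IsHomDer.eq_zero [CharZero F] {m : ℤ} {ξ : Derivation ℂ A A} (hξ : S.IsHomDer m ξ)
    (hm : m < -1) : ξ = 0 := by
  obtain ⟨p, hp, hpm⟩ := S.exists_j_eq_mul_derivative ξ
    fun a ha => IsHomDer.apply_zero S hξ (by omega) ha
  have hp0 : p = 0 := by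
    ext n; exact hpm m hξ n (by omega)
  ext a
  apply S.j_injective
  rw [hp, hp0]; simp

lemma IsHomDer.exists_j_eq [CharZero F] {ν : Derivation ℂ A A} (hν : S.IsHomDer (-1) ν) :
    ∃ c : F, ∀ a, S.j (ν a) = C c * derivative (S.j a) := by
  obtain ⟨p, hp, hpm⟩ := S.exists_j_eq_mul_derivative ν
    fun a ha => IsHomDer.apply_zero S hν (by omega) ha
  refine ⟨p.coeff 0, fun a => ?_⟩
  rw [hp]
  congr 1
  ext n
  rw [coeff_C]
  split_ifs with hn
  · rw [hn]
  · exact hpm _ hν n (by omega)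

/-- A vertical field of degree `m - 1` is a multiple of the Euler field up to sections. -/
lemma smul_eq_smul_euler [CharZero F] {ν : Derivation ℂ A A} (hν : S.IsHomDer (-1) ν) {m : ℤ}
    {a : A} (ha : S.IsHom m a) : (m : A) • a • ν = ν a • S.euler := by
  obtain ⟨c, hc⟩ := IsHomDer.exists_j_eq S hν
  ext b
  apply S.j_injective
  have h := congrArg S.j ha
  rw [j_euler, map_mul, map_intCast] at h
  simp only [Derivation.smul_apply, smul_eq_mul, map_mul, map_intCast, hc, j_euler]
  linear_combination (-C c * derivative (S.j b)) * h

end AffineFrame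

namespace AffineFrame

variable {A : Type*} [CommRing A] [Algebra ℂ A] {F : Type*} [Field F] [Algebra ℂ F]
  {k : ℕ} (S : AffineFrame A F k)

lemma coeff_j_lie_euler_sub [CharZero F] {ξ : Derivation ℂ A A} {s : ℤ} {l : ℕ} {x : A}
    (hx : S.IsHom l x) (n : ℕ) : (S.j ((⁅S.euler, ξ⁆ - (s : ℂ) • ξ) x)).coeff n =
      ((n : F) - l - s) * (S.j (ξ x)).coeff n := by
  have h : (⁅S.euler, ξ⁆ - (s : ℂ) • ξ) x = S.euler (ξ x) - ((l + s : ℤ) : A) * ξ x := by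
    unfold IsHom at hx
    simp only [Derivation.sub_apply, Derivation.commutator_apply, Derivation.smul_apply, hx,
      Derivation.leibniz, Derivation.map_intCast, smul_eq_mul, Algebra.smul_def, map_intCast]
    push_cast; ring
  rw [h, map_sub, map_mul, map_intCast, j_euler, coeff_sub, coeff_X_mul_derivative,
    ← C_eq_intCast, coeff_C_mul]
  push_cast; ring

lemma exists_sum_isHomDer_of_support [CharZero F] {G : Set A} (hG : Algebra.adjoin ℂ G = ⊤)
    {deg : A → ℕ} (hdeg : ∀ x ∈ G, S.IsHom (deg x) x) (T : Finset ℤ) (ξ : Derivation ℂ A A)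
    (hξ : ∀ x ∈ G, ∀ n : ℕ, (S.j (ξ x)).coeff n ≠ 0 → (n : ℤ) - deg x ∈ T) :
    ∃ c : ℤ → Derivation ℂ A A, (∀ m ∈ T, S.IsHomDer m (c m)) ∧ ξ = ∑ m ∈ T, c m := by
  induction T using Finset.induction_on generalizing ξ with
  | empty =>
    refine ⟨0, by simp, ?_⟩
    rw [Finset.sum_empty]
    refine Derivation.ext_of_adjoin_eq_top G hG fun x hx => ?_
    apply S.j_injective
    ext n
    by_contra hne
    exact absurd (hξ x hx n (by simpa using hne)) (by simp)
  | insert s T hs ih =>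
    obtain ⟨c, hc, hsum⟩ := ih (⁅S.euler, ξ⁆ - (s : ℂ) • ξ) (by
      intro x hx n hn
      rw [S.coeff_j_lie_euler_sub (hdeg x hx)] at hn
      have h := hξ x hx n (right_ne_zero_of_mul hn)
      rcases Finset.mem_insert.1 h with h | h
      · refine absurd ?_ (left_ne_zero_of_mul hn)
        have : ((n : ℤ) : F) - ((deg x : ℤ) : F) = (s : F) := by rw [← h]; push_cast; ring
        push_cast at this
        rw [this, sub_self]
      · exact h)
    set c' : ℤ → Derivation ℂ A A := fun m => ((m : ℂ) - s)⁻¹ • c m with hc'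
    have hne : ∀ m ∈ T, (m : ℂ) - s ≠ 0 := fun m hm => sub_ne_zero.2 (by
      intro h
      exact hs (by rwa [← (by exact_mod_cast h : m = s)]))
    have hhom : ∀ m ∈ T, S.IsHomDer m (c' m) := by
      intro m hm a
      simp only [hc', Derivation.smul_apply, Derivation.map_smul, hc m hm a, smul_add,
        mul_smul_comm]
    refine ⟨fun m => if m = s then ξ - ∑ m ∈ T, c' m else c' m, ?_, ?_⟩
    · intro m hm
      rcases Finset.mem_insert.1 hm with rfl | hm
      · simp only [if_true]
        have h1 : ⁅S.euler, ξ - ∑ i ∈ T, c' i⁆ = (m : ℂ) • (ξ - ∑ i ∈ T, c' i) := by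
          have h2 : ∀ i ∈ T, ⁅S.euler, c' i⁆ = c i + (m : ℂ) • c' i := by
            intro i hi
            have h3 : ⁅S.euler, c' i⁆ = (i : ℂ) • c' i := by
              ext a
              have h4 : ((i : ℂ) • c' i) a = (i : A) * c' i a := by
                rw [Derivation.smul_apply, Algebra.smul_def, map_intCast]
              rw [h4, Derivation.commutator_apply, hhom i hi a, add_sub_cancel_left]
            rw [h3]
            have h4 : c i = ((i : ℂ) - m) • c' i := by
              rw [hc', smul_smul, mul_inv_cancel₀ (hne i hi), one_smul]
            rw [h4, ← add_smul]; congr 1; ring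
          rw [lie_sub, lie_sum, Finset.sum_congr rfl h2, Finset.sum_add_distrib, ← hsum,
            ← Finset.smul_sum, smul_sub]
          abel
        intro a
        have h2 := congrArg (fun η : Derivation ℂ A A => η a) h1
        simp only [Derivation.commutator_apply, Derivation.smul_apply, Algebra.smul_def,
          map_intCast] at h2
        rw [← h2]; ring
      · have hms : m ≠ s := fun h => hs (h ▸ hm)
        simp only [if_neg hms]
        exact hhom m hm
    · have h1 : ∀ m ∈ T, (if m = s then ξ - ∑ m ∈ T, c' m else c' m) = c' m :=
        fun m hm => if_neg fun (h : m = s) => hs (h ▸ hm)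
      rw [Finset.sum_insert hs, Finset.sum_congr rfl h1, if_pos rfl, sub_add_cancel]

lemma exists_homogeneous_generators [CharZero F] (hfg : Algebra.FiniteType ℂ A) :
    ∃ G : Finset A, Algebra.adjoin ℂ (G : Set A) = ⊤ ∧
      ∃ deg : A → ℕ, ∀ x ∈ G, S.IsHom (deg x) x := by
  classical
  obtain ⟨G, hG⟩ := hfg.out
  choose b hb using S.exists_component
  refine ⟨G.biUnion fun a => (S.j a).support.image (b a), ?_, ?_⟩
  · rw [eq_top_iff, ← hG, Algebra.adjoin_le_iff]
    intro a ha
    have : a = ∑ n ∈ (S.j a).support, b a n := by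
      apply S.j_injective
      conv_lhs => rw [(S.j a).as_sum_support]
      rw [map_sum]
      exact Finset.sum_congr rfl fun n _ => (hb a n).symm
    rw [this]
    refine Subalgebra.sum_mem _ fun n hn => Algebra.subset_adjoin ?_
    simp only [Finset.coe_biUnion, Set.mem_iUnion]
    exact ⟨a, ha, Finset.mem_coe.2 (Finset.mem_image_of_mem _ hn)⟩
  · have h : ∀ x : A, ∃ n : ℕ, x ∈ G.biUnion (fun a => (S.j a).support.image (b a)) →
        S.IsHom n x := by
      intro x
      by_cases hx : x ∈ G.biUnion (fun a => (S.j a).support.image (b a))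
      · obtain ⟨a, _, ha⟩ := Finset.mem_biUnion.1 hx
        obtain ⟨n, _, rfl⟩ := Finset.mem_image.1 ha
        exact ⟨n, fun _ => S.isHom_of_j_eq (hb a n)⟩
      · exact ⟨0, fun h => absurd h hx⟩
    choose deg hdeg using h
    exact ⟨deg, hdeg⟩

lemma exists_sum_isHomDer [CharZero F] (hfg : Algebra.FiniteType ℂ A) (ξ : Derivation ℂ A A) :
    ∃ (T : Finset ℤ) (c : ℤ → Derivation ℂ A A), (∀ m ∈ T, S.IsHomDer m (c m)) ∧
      ξ = ∑ m ∈ T, c m ∧ ∀ m ∈ T, ∃ (x : A) (d n : ℕ), S.IsHom d x ∧ (S.j (ξ x)).coeff n ≠ 0 ∧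
        m = (n : ℤ) - d := by
  obtain ⟨G, hG, deg, hdeg⟩ := S.exists_homogeneous_generators hfg
  set T := G.biUnion fun x => (S.j (ξ x)).support.image fun n : ℕ => (n : ℤ) - deg x with hT
  obtain ⟨c, hc, hsum⟩ := S.exists_sum_isHomDer_of_support hG hdeg T ξ fun x hx n hn =>
    Finset.mem_biUnion.2 ⟨x, hx, Finset.mem_image_of_mem _ (mem_support_iff.2 hn)⟩
  refine ⟨T, c, hc, hsum, fun m hm => ?_⟩
  obtain ⟨x, hx, hm⟩ := Finset.mem_biUnion.1 hm
  obtain ⟨n, hn, rfl⟩ := Finset.mem_image.1 hm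
  exact ⟨x, deg x, n, hdeg x hx, mem_support_iff.1 hn, rfl⟩

/-- For divergence-free `ξ` of degree `m`, a divergence-free correction of `(m + 2) • f • ξ`. -/
def lift (m : ℤ) (f : A) (ξ : Derivation ℂ A A) : Derivation ℂ A A :=
  ((m + 2 : ℤ) : A) • f • ξ - ξ f • S.euler

lemma isHomDer_lift [CharZero F] {m : ℤ} {f : A} {ξ : Derivation ℂ A A} (hf : S.IsHom 1 f)
    (hξ : S.IsHomDer m ξ) : S.IsHomDer (m + 1) (S.lift m f ξ) := by
  have h0 : S.IsHom 0 ((m + 2 : ℤ) : A) := by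
    unfold IsHom; rw [Derivation.map_intCast]; simp
  have h1 := IsHomDer.smul h0 (IsHomDer.smul hf hξ)
  have h2 := IsHomDer.smul (hξ.apply hf) S.isHomDer_euler
  rw [show (0 : ℤ) + (1 + m) = m + 1 by ring] at h1
  rw [add_zero] at h2
  exact h1.sub h2

lemma sum_lie_ν_lift [CharZero F] {m : ℤ} {ξ : Derivation ℂ A A} (hξ : S.IsHomDer m ξ) :
    ∑ i, ⁅S.ν i, S.lift m (S.f i) ξ⁆ = (((m + 2) * (m + 1) : ℤ) : A) • ξ := by
  ext a
  have h1 : ∀ i, (⁅S.ν i, S.lift m (S.f i) ξ⁆ : Derivation ℂ A A) a =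
      ((m + 2 : ℤ) : A) * (S.ν i (S.f i) * ξ a + S.f i * S.ν i (ξ a) - ξ (S.f i * S.ν i a)) := by
    intro i
    have h2 := congrArg (fun η : Derivation ℂ A A => η a)
      (S.smul_eq_smul_euler (S.isHomDer_ν i) (hξ.apply (S.isHom_f i)))
    have h3 := S.isHomDer_ν i a
    simp only [Derivation.smul_apply, smul_eq_mul] at h2
    simp only [lift, Derivation.commutator_apply, Derivation.sub_apply, Derivation.smul_apply,
      smul_eq_mul, map_sub, Derivation.leibniz, Derivation.map_intCast]
    rw [h3]
    push_cast at h2 ⊢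
    linear_combination h2
  rw [← Derivation.coeFnAddMonoidHom_apply, map_sum, Finset.sum_apply]
  simp only [Derivation.coeFnAddMonoidHom_apply]
  rw [Finset.sum_congr rfl fun i _ => h1 i, ← Finset.mul_sum, Finset.sum_sub_distrib,
    Finset.sum_add_distrib, ← Finset.sum_mul, ← map_sum, S.sum_ν_f, ← S.euler_apply,
    ← S.euler_apply, hξ a, Derivation.smul_apply, smul_eq_mul]
  push_cast; ring

section Divergence

variable {D : Derivation ℂ A A →+ A}
  (hG : ∀ m ξ, S.IsHomDer m ξ → S.IsHom m (D ξ))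
  (hU : ∀ ν m ξ, S.IsHomDer (-1) ν → S.IsHomDer m ξ → D ⁅ν, ξ⁆ = ν (D ξ))

lemma map_intCast_smul (D : Derivation ℂ A A →+ A) (n : ℤ) (ξ : Derivation ℂ A A) :
    D ((n : A) • ξ) = n * D ξ := by
  rw [Int.cast_smul_eq_zsmul, map_zsmul, zsmul_eq_mul]

include hU in
lemma map_smul_lie [CharZero F] {m : ℤ} {r : A} {ν η : Derivation ℂ A A} (hr : S.IsHom 0 r)
    (hν : S.IsHomDer (-1) ν) (hη : S.IsHomDer m η) :
    D (r • ⁅ν, η⁆) = r * D ⁅ν, η⁆ + D (η r • ν) := by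
  have h1 : ⁅r • ν, η⁆ = r • ⁅ν, η⁆ - η r • ν := by
    ext a
    simp only [Derivation.commutator_apply, Derivation.sub_apply, Derivation.smul_apply,
      smul_eq_mul, Derivation.leibniz]
    ring
  have hrν : S.IsHomDer (-1) (r • ν) := by simpa using IsHomDer.smul hr hν
  have h2 := hU _ _ _ hrν hη
  rw [h1, map_sub, Derivation.smul_apply, smul_eq_mul, ← hU _ _ _ hν hη] at h2
  linear_combination h2

include hU in
lemma map_smul_degree_zero [CharZero F] {m : ℤ} {r : A} {ξ : Derivation ℂ A A}
    (hr : S.IsHom 0 r) (hξ : S.IsHomDer m ξ) :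
    (((m + 2) * (m + 1) : ℤ) : A) * D (r • ξ) =
      (((m + 2) * (m + 1) : ℤ) : A) * (r * D ξ) + ((m + 2 : ℤ) : A) * D (ξ r • S.euler) := by
  have hE : S.euler r = 0 := by
    have := hr; unfold IsHom at this; simpa using this
  have h1 := congrArg (fun η => D (r • η)) (S.sum_lie_ν_lift hξ)
  have h0 := congrArg D (S.sum_lie_ν_lift hξ)
  simp only [Finset.smul_sum, map_sum, smul_comm r, map_intCast_smul] at h1 h0
  rw [← h1, mul_left_comm, ← h0, Finset.mul_sum, ← map_intCast_smul, ← sub_eq_iff_eq_add',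
    ← Finset.sum_sub_distrib]
  have h2 : ∀ i, D (r • ⁅S.ν i, S.lift m (S.f i) ξ⁆) - r * D ⁅S.ν i, S.lift m (S.f i) ξ⁆ =
      D (((m + 2 : ℤ) : A) • ξ r • S.f i • S.ν i) := by
    intro i
    rw [S.map_smul_lie hU hr (S.isHomDer_ν i) (S.isHomDer_lift (S.isHom_f i) hξ),
      add_sub_cancel_left]
    congr 1
    simp only [lift, Derivation.sub_apply, Derivation.smul_apply, smul_eq_mul, hE, mul_zero,
      sub_zero, smul_smul]
    congr 1; ring
  rw [Finset.sum_congr rfl fun i _ => h2 i, ← map_sum, ← Finset.smul_sum, ← Finset.smul_sum]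
  rfl

variable [IsDomain A] [CharZero A]

include hG hU in
lemma map_lift_eq_zero [CharZero F] {f : A} (hf : S.IsHom 1 f) (n : ℕ) {ξ : Derivation ℂ A A}
    (hξ : S.IsHomDer ((n : ℤ) - 1) ξ) (hD : D ξ = 0) : D (S.lift ((n : ℤ) - 1) f ξ) = 0 := by
  induction n generalizing ξ with
  | zero =>
    have hξ' : S.IsHomDer (-1) ξ := by simpa using hξ
    have h := S.smul_eq_smul_euler hξ' hf
    rw [lift, ← h]
    simp
  | succ n ih =>
    have e : ((n + 1 : ℕ) : ℤ) - 1 = n := by push_cast; ring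
    rw [e] at hξ ⊢
    have hlift := S.isHomDer_lift hf hξ
    have hν : ∀ i, S.ν i (D (S.lift n f ξ)) = 0 := by
      intro i
      have hνi := S.isHomDer_ν i
      rw [← hU _ _ _ hνi hlift]
      have hξ1 : S.IsHomDer ((n : ℤ) - 1) ⁅S.ν i, ξ⁆ := by
        have := hνi.lie hξ
        rwa [show -1 + (n : ℤ) = n - 1 by ring] at this
      have h1 := ih hξ1 (by rw [hU _ _ _ hνi hξ, hD, map_zero])
      have hr : S.IsHom 0 (S.ν i f) := hνi.apply hf
      have h2 := S.map_smul_degree_zero hU hr hξ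
      rw [hD, mul_zero, mul_zero, zero_add] at h2
      have h3 := S.smul_eq_smul_euler hνi (hξ.apply hf)
      have key : ((n + 1 : ℤ) : A) • ⁅S.ν i, S.lift n f ξ⁆ =
          ((n + 2 : ℤ) : A) • S.lift ((n : ℤ) - 1) f ⁅S.ν i, ξ⁆ +
          ((((n + 2) * (n + 1) : ℤ) : A) • S.ν i f • ξ -
            ((n + 2 : ℤ) : A) • ξ (S.ν i f) • S.euler) := by
        ext a
        have h3a := congrArg (fun η : Derivation ℂ A A => η a) h3
        have h4 := hνi a
        simp only [Derivation.smul_apply, smul_eq_mul] at h3a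
        simp only [lift, Derivation.commutator_apply, Derivation.sub_apply, Derivation.smul_apply,
          Derivation.add_apply, smul_eq_mul, map_sub, Derivation.leibniz, Derivation.map_intCast]
        rw [h4]
        push_cast at h3a ⊢
        linear_combination -h3a
      have h5 := congrArg D key
      rw [map_add, map_sub] at h5
      simp only [map_intCast_smul] at h5
      rw [h1, h2, mul_zero, sub_self, add_zero] at h5
      exact (mul_eq_zero.1 h5).resolve_left (by exact_mod_cast (by omega : (n + 1 : ℤ) ≠ 0))
    have hE := hG _ _ hlift
    rw [IsHom, euler_apply, Finset.sum_eq_zero fun i _ => by rw [hν i, mul_zero]] at hE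
    exact (mul_eq_zero.1 hE.symm).resolve_left (by exact_mod_cast (by omega : (n + 1 : ℤ) ≠ 0))

include hG hU in
/-- Divergence-free fields are spanned by brackets with sections, up to sections. -/
lemma exists_sub_mem_of_map_eq_zero [CharZero F] (hfg : Algebra.FiniteType ℂ A)
    (W : Submodule ℂ (Derivation ℂ A A))
    (hW : ∀ ν ξ, S.IsHomDer (-1) ν → D ν = 0 → D ξ = 0 → ⁅ν, ξ⁆ ∈ W)
    {κ : Derivation ℂ A A} (hκ : D κ = 0) :
    ∃ ν, S.IsHomDer (-1) ν ∧ κ - ν ∈ W := by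
  classical
  obtain ⟨T, c, hc, rfl, -⟩ := S.exists_sum_isHomDer hfg κ
  have hDc : ∀ m ∈ T, D (c m) = 0 := by
    intro m hm
    apply S.j_injective
    rw [map_zero]
    ext n
    rw [coeff_zero]
    by_cases hn : (n : ℤ) = m
    · have h := congrArg (fun a => (S.j a).coeff n) hκ
      simp only [map_sum, finset_sum_coeff, map_zero, coeff_zero] at h
      rwa [Finset.sum_eq_single_of_mem m hm] at h
      intro m' hm' hne
      exact S.isHom_iff.1 (hG _ _ (hc m' hm')) n (by rw [hn]; exact hne.symm)
    · exact S.isHom_iff.1 (hG _ _ (hc m hm)) n hn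
  have hmem : ∀ m ∈ T, m ≠ -1 → c m ∈ W := by
    intro m hm hne
    rcases lt_or_gt_of_ne hne with h | h
    · rw [IsHomDer.eq_zero S (hc m hm) h]; exact W.zero_mem
    obtain ⟨n, rfl⟩ : ∃ n : ℕ, m = (n : ℤ) - 1 := ⟨(m + 1).toNat, by omega⟩
    have h1 := S.sum_lie_ν_lift (hc _ hm)
    have h2 : ((((n : ℤ) - 1 + 2) * ((n : ℤ) - 1 + 1) : ℤ) : ℂ) • c ((n : ℤ) - 1) ∈ W := by
      have : ((((n : ℤ) - 1 + 2) * ((n : ℤ) - 1 + 1) : ℤ) : ℂ) • c ((n : ℤ) - 1) =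
          ∑ i, ⁅S.ν i, S.lift ((n : ℤ) - 1) (S.f i) (c ((n : ℤ) - 1))⁆ := by
        rw [h1, Int.cast_smul_eq_zsmul, Int.cast_smul_eq_zsmul]
      rw [this]
      exact W.sum_mem fun i _ => hW _ _ (S.isHomDer_ν i)
        ((hG _ _ (S.isHomDer_ν i)).eq_zero S (by norm_num))
        (S.map_lift_eq_zero hG hU (S.isHom_f i) n (hc _ hm) (hDc _ hm))
    refine (W.smul_mem_iff ?_).1 h2
    have : (((n : ℤ) - 1 + 2) * ((n : ℤ) - 1 + 1) : ℤ) ≠ 0 :=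
      mul_ne_zero (by omega) (by omega)
    exact_mod_cast this
  by_cases h : (-1 : ℤ) ∈ T
  · refine ⟨c (-1), hc _ h, ?_⟩
    rw [← Finset.add_sum_erase _ _ h, add_sub_cancel_left]
    exact W.sum_mem fun m hm => hmem m (Finset.mem_of_mem_erase hm) (Finset.ne_of_mem_erase hm)
  · refine ⟨0, fun a => by simp, ?_⟩
    rw [sub_zero]
    exact W.sum_mem fun m hm => hmem m hm fun h' => h (h' ▸ hm)

end Divergence

end AffineFrame

section Conj

variable {A : Type*} [CommRing A] [Algebra ℂ A]

/-- The push-forward `g ∘ ξ ∘ g⁻¹` of a derivation. -/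
def Derivation.conj (g : A ≃ₐ[ℂ] A) (ξ : Derivation ℂ A A) : Derivation ℂ A A :=
  Derivation.mk' (g.toLinearMap ∘ₗ ξ.toLinearMap ∘ₗ g.symm.toLinearMap) fun a b => by simp

@[simp]
lemma Derivation.conj_apply (g : A ≃ₐ[ℂ] A) (ξ : Derivation ℂ A A) (a : A) :
    ξ.conj g a = g (ξ (g.symm a)) := rfl

lemma Derivation.conj_eq_self {g : A ≃ₐ[ℂ] A} {ξ : Derivation ℂ A A}
    (h : ∀ a, ξ (g a) = g (ξ a)) : ξ.conj g = ξ := by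
  ext a
  rw [conj_apply, ← h, AlgEquiv.apply_symm_apply]

namespace VolumeForms

variable (Ω : VolumeForms A)

/-- The coefficient of a top form with respect to the volume form. -/
def volEquiv : A ≃ₗ[A] Ω.F2 :=
  LinearEquiv.ofBijective (LinearMap.toSpanSingleton A Ω.F2 Ω.vol) Ω.vol_basis

lemma volEquiv_apply (a : A) : Ω.volEquiv a = a • Ω.vol := rfl

/-- The divergence with respect to the volume form. -/
def div : Derivation ℂ A A →+ A :=
  (Ω.volEquiv.symm.toLinearMap.toAddMonoidHom.comp Ω.d1.toAddMonoidHom).comp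
    (Ω.ι2.flip Ω.vol).toAddMonoidHom

lemma div_smul_vol (ξ : Derivation ℂ A A) : Ω.div ξ • Ω.vol = Ω.d1 (Ω.ι2 ξ Ω.vol) := by
  rw [← volEquiv_apply]
  exact Ω.volEquiv.apply_symm_apply _

lemma smul_vol_injective {a b : A} (h : a • Ω.vol = b • Ω.vol) : a = b := Ω.vol_basis.1 h

lemma div_eq_zero_iff (ξ : Derivation ℂ A A) : Ω.div ξ = 0 ↔ Ω.d1 (Ω.ι2 ξ Ω.vol) = 0 := by
  rw [← div_smul_vol, ← volEquiv_apply, LinearEquiv.map_eq_zero_iff]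

/-- The Jacobian factor of an automorphism. -/
def jac (g : A ≃ₐ[ℂ] A) : A := Ω.volEquiv.symm (Ω.push2 g Ω.vol)

lemma jac_smul_vol (g : A ≃ₐ[ℂ] A) : Ω.jac g • Ω.vol = Ω.push2 g Ω.vol := by
  rw [← volEquiv_apply]
  exact Ω.volEquiv.apply_symm_apply _

lemma jac_one : Ω.jac 1 = 1 := by
  apply Ω.smul_vol_injective
  rw [jac_smul_vol, Ω.push2_one, one_smul]; rfl

lemma jac_mul (g h : A ≃ₐ[ℂ] A) : Ω.jac (g * h) = g (Ω.jac h) * Ω.jac g := by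
  apply Ω.smul_vol_injective
  rw [jac_smul_vol, Ω.push2_mul, ← jac_smul_vol, Ω.push2_smul, ← jac_smul_vol, mul_smul]

lemma isUnit_jac (g : A ≃ₐ[ℂ] A) : IsUnit (Ω.jac g) := by
  have h := Ω.jac_mul g g⁻¹
  rw [mul_inv_cancel, jac_one] at h
  exact IsUnit.of_mul_eq_one_right _ h.symm

/-- The derivations `ξ` for which the contraction of the volume form with `ξ` is natural with
respect to `g`. -/
def naturality (g : A ≃ₐ[ℂ] A) : Submodule A (Derivation ℂ A A) where
  carrier := {ξ | Ω.push1 g (Ω.ι2 ξ Ω.vol) = Ω.ι2 (ξ.conj g) (Ω.push2 g Ω.vol)}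
  zero_mem' := by
    have : (0 : Derivation ℂ A A).conj g = 0 := by ext; simp
    simp [this]
  add_mem' := by
    intro ξ η hξ hη
    have : (ξ + η).conj g = ξ.conj g + η.conj g := by ext; simp
    simp only [Set.mem_setOf_eq] at *
    simp [this, hξ, hη]
  smul_mem' := by
    intro a ξ hξ
    have : (a • ξ).conj g = g a • ξ.conj g := by ext; simp
    simp only [Set.mem_setOf_eq] at *
    simp [this, hξ, Ω.push1_smul]

lemma mem_naturality {g : A ≃ₐ[ℂ] A} {ξ : Derivation ℂ A A} : ξ ∈ Ω.naturality g ↔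
    Ω.push1 g (Ω.ι2 ξ Ω.vol) = Ω.ι2 (ξ.conj g) (Ω.push2 g Ω.vol) := Iff.rfl

lemma mem_naturality_of_commute {g : A ≃ₐ[ℂ] A} {ξ : Derivation ℂ A A}
    (h : ∀ a, ξ (g a) = g (ξ a)) : ξ ∈ Ω.naturality g := by
  rw [mem_naturality, Derivation.conj_eq_self h]
  exact Ω.push_ι2 g ξ _ h

lemma smul_injective_F1 [IsDomain A] {a : A} (ha : a ≠ 0) {x y : Ω.F1} (h : a • x = a • y) :
    x = y := by
  obtain ⟨ξ, rfl⟩ := Ω.theta_bij.2 x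
  obtain ⟨η, rfl⟩ := Ω.theta_bij.2 y
  have h1 : a • ξ = a • η := Ω.theta_bij.1 (by simpa using h)
  congr 1
  ext b
  have := congrArg (fun ζ : Derivation ℂ A A => ζ b) h1
  exact mul_left_cancel₀ ha this

lemma mem_naturality_of_smul [IsDomain A] {g : A ≃ₐ[ℂ] A} {ξ : Derivation ℂ A A} {a : A}
    (ha : a ≠ 0) (h : a • ξ ∈ Ω.naturality g) : ξ ∈ Ω.naturality g := by
  have : (a • ξ).conj g = g a • ξ.conj g := by ext; simp
  rw [mem_naturality, this, map_smul, map_smul, LinearMap.smul_apply, LinearMap.smul_apply,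
    Ω.push1_smul] at h
  exact Ω.smul_injective_F1 (by simpa using ha) h

lemma div_conj [Nontrivial A] {g : A ≃ₐ[ℂ] A} {ξ : Derivation ℂ A A} (h : ξ ∈ Ω.naturality g)
    {z : ℂ} (hz : Ω.jac g = algebraMap ℂ A z) : Ω.div (ξ.conj g) = g (Ω.div ξ) := by
  have hz0 : z ≠ 0 := by
    rintro rfl
    have := Ω.isUnit_jac g
    rw [hz, map_zero] at this
    exact not_isUnit_zero this
  rw [mem_naturality, ← jac_smul_vol, hz, map_smul, algebraMap_smul] at h
  have h1 := congrArg Ω.d1 h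
  rw [Ω.push_d1, map_smul, ← div_smul_vol, ← div_smul_vol, Ω.push2_smul, ← jac_smul_vol, hz,
    ← algebraMap_smul A z, smul_comm] at h1
  simp only [smul_smul] at h1
  have h2 := Ω.smul_vol_injective h1
  exact (((IsUnit.mk0 z hz0).map (algebraMap ℂ A)).mul_left_cancel h2).symm

end VolumeForms

end Conj

namespace AffineFrame

variable {A : Type*} [CommRing A] [Algebra ℂ A] {F : Type*} [Field F] [Algebra ℂ F]
  {k : ℕ} (S : AffineFrame A F k)

/-- `g` is induced by the substitution `X ↦ u * X + c`. -/
def IsSubst (g : A ≃ₐ[ℂ] A) (u c : F) : Prop := ∀ a, S.j (g a) = (S.j a).comp (C u * X + C c)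

variable {S} in
lemma IsSubst.mul {g h : A ≃ₐ[ℂ] A} {u c u' c' : F} (hg : S.IsSubst g u c)
    (hh : S.IsSubst h u' c') : S.IsSubst (g * h) (u' * u) (u' * c + c') := by
  intro a
  rw [AlgEquiv.mul_apply, hg, hh, comp_assoc]
  congr 1
  simp; ring

variable {S} in
lemma IsSubst.eq_one {g : A ≃ₐ[ℂ] A} (hg : S.IsSubst g 1 0) : g = 1 := by
  ext a
  apply S.j_injective
  rw [hg]; simp

lemma exists_isSubst {u c u' c' : F} (h1 : u * u' = 1) (h2 : u * c' + c = 0)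
    (h3 : u' * c + c' = 0) (hb : ∀ a, ∃ b, S.j b = (S.j a).comp (C u * X + C c))
    (hb' : ∀ a, ∃ b, S.j b = (S.j a).comp (C u' * X + C c')) :
    ∃ g, S.IsSubst g u c := by
  choose b hb using hb
  choose b' hb' using hb'
  let h : A →ₐ[ℂ] A := AlgHom.ofLinearMap
    { toFun := b
      map_add' := fun x y => S.j_injective (by simp [hb])
      map_smul' := fun z x => S.j_injective (by
        rw [hb, RingHom.id_apply, map_smul, map_smul, hb, ← algebraMap_smul F z,
          ← algebraMap_smul F z (Polynomial.comp _ _), smul_comp]) }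
    (S.j_injective (by simp [hb])) fun x y => S.j_injective (by simp [hb])
  have e1 : ∀ a, b (b' a) = a := fun a => S.j_injective (by
    have : (C u' * X + C c').comp (C u * X + C c) = X := by
      simp only [add_comp, mul_comp, C_comp, X_comp, mul_add, ← mul_assoc, ← C_mul]
      rw [mul_comm u', h1, C_1, one_mul, add_assoc, ← C_add, h3, C_0, add_zero]
    rw [hb, hb', comp_assoc, this, comp_X])
  have e2 : ∀ a, b' (b a) = a := fun a => S.j_injective (by
    have : (C u * X + C c).comp (C u' * X + C c') = X := by
      simp only [add_comp, mul_comp, C_comp, X_comp, mul_add, ← mul_assoc, ← C_mul]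
      rw [h1, C_1, one_mul, add_assoc, ← C_add, h2, C_0, add_zero]
    rw [hb', hb, comp_assoc, this, comp_X])
  exact ⟨AlgEquiv.ofBijective h
    ⟨Function.LeftInverse.injective e2, Function.RightInverse.surjective e1⟩, hb⟩

lemma exists_isSubst_scale [CharZero F] {z : ℂ} (hz : z ≠ 0) :
    ∃ g, S.IsSubst g (algebraMap ℂ F z) 0 := by
  have key : ∀ z : ℂ, ∀ a, ∃ b, S.j b = (S.j a).comp (C (algebraMap ℂ F z) * X + C 0) := by
    intro z a
    induction a using S.hom_induction with
    | zero => exact ⟨0, by simp⟩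
    | add a b ha hb =>
      obtain ⟨a', ha⟩ := ha
      obtain ⟨b', hb⟩ := hb
      exact ⟨a' + b', by rw [map_add, ha, hb, map_add, add_comp]⟩
    | hom n a ha =>
      refine ⟨z ^ n • a, ?_⟩
      rw [map_smul, IsHom.j_eq S ha, ← C_mul_X_pow_eq_monomial, mul_comp, C_comp, pow_comp,
        X_comp, C_0, add_zero, mul_pow, ← algebraMap_smul F, smul_eq_C_mul, map_pow, C_pow]
      ring
  have h1 : algebraMap ℂ F z * algebraMap ℂ F z⁻¹ = 1 := by
    rw [← map_mul, mul_inv_cancel₀ hz, map_one]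
  exact S.exists_isSubst h1 (by simp) (by simp) (key z) (key z⁻¹)

/-- Exponential series of a derivation acting on an element of degree `n`. -/
lemma j_sum_iterate [CharZero F] {ν : Derivation ℂ A A} {c : F}
    (hν : ∀ a, S.j (ν a) = C c * derivative (S.j a)) {n : ℕ} {a : A} (ha : S.IsHom n a) :
    S.j (∑ l ∈ Finset.range (n + 1), (l.factorial : ℂ)⁻¹ • ν^[l] a) =
      (S.j a).comp (C 1 * X + C c) := by
  have hpow : ∀ l : ℕ, S.j (ν^[l] a) = C c ^ l * derivative^[l] (S.j a) := by
    intro l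
    induction l with
    | zero => simp
    | succ l ih =>
      rw [Function.iterate_succ_apply', Function.iterate_succ_apply', hν, ih,
        ← C_pow, derivative_C_mul]; simp only [C_pow]; ring
  rw [map_sum]
  simp only [map_smul, hpow]
  rw [IsHom.j_eq S ha, ← C_mul_X_pow_eq_monomial, mul_comp, C_comp, pow_comp, X_comp, C_1,
    one_mul, add_comm X, add_pow, Finset.mul_sum]
  refine Finset.sum_congr rfl fun l hl => ?_
  rw [iterate_derivative_C_mul, iterate_derivative_X_pow_eq_natCast_mul,
    Nat.descFactorial_eq_factorial_mul_choose]
  have hne : (l.factorial : ℂ) ≠ 0 := by exact_mod_cast l.factorial_ne_zero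
  rw [inv_smul_eq_iff₀ hne, Nat.cast_smul_eq_nsmul, nsmul_eq_mul]
  push_cast; ring

lemma exists_isSubst_shift [CharZero F] {ν : Derivation ℂ A A} {c : F}
    (hν : ∀ a, S.j (ν a) = C c * derivative (S.j a)) : ∃ g, S.IsSubst g 1 c := by
  have key : ∀ (ν : Derivation ℂ A A) (c : F), (∀ a, S.j (ν a) = C c * derivative (S.j a)) →
      ∀ a, ∃ b, S.j b = (S.j a).comp (C 1 * X + C c) := by
    intro ν c hν a
    induction a using S.hom_induction with
    | zero => exact ⟨0, by simp⟩
    | add a b ha hb =>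
      obtain ⟨a', ha⟩ := ha
      obtain ⟨b', hb⟩ := hb
      exact ⟨a' + b', by rw [map_add, ha, hb, map_add, add_comp]⟩
    | hom n a ha => exact ⟨_, S.j_sum_iterate hν ha⟩
  exact S.exists_isSubst (u := 1) (u' := 1) (c' := -c) (by simp) (by simp) (by simp) (key ν c hν)
    (key (-ν) (-c) fun a => by simp [hν])

end AffineFrame

namespace AffineFrame

variable {A : Type*} [CommRing A] [Algebra ℂ A] {F : Type*} [Field F] [Algebra ℂ F]
  {k : ℕ} {S : AffineFrame A F k}

lemma IsSubst.apply_unit {g : A ≃ₐ[ℂ] A} {u c : F} (hg : S.IsSubst g u c) {a : A}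
    (ha : IsUnit a) : g a = a := by
  apply S.j_injective
  obtain ⟨r, -, hr⟩ := Polynomial.isUnit_iff.1 (ha.map S.j)
  rw [hg, ← hr, C_comp]

lemma IsSubst.apply_of_isHom [CharZero F] {g : A ≃ₐ[ℂ] A} {z : ℂ}
    (hg : S.IsSubst g (algebraMap ℂ F z) 0) {n : ℕ} {a : A} (ha : S.IsHom n a) :
    g a = z ^ n • a := by
  apply S.j_injective
  rw [hg, map_smul, IsHom.j_eq S ha, ← C_mul_X_pow_eq_monomial, mul_comp, C_comp, pow_comp,
    X_comp, C_0, add_zero, mul_pow, ← algebraMap_smul F, smul_eq_C_mul, map_pow, C_pow]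
  ring

lemma IsSubst.pow_eq_one {g : A ≃ₐ[ℂ] A} {u : F} (hg : S.IsSubst g u 0) {N : ℕ}
    (hu : u ^ N = 1) : g ^ N = 1 := by
  have h : ∀ n : ℕ, S.IsSubst (g ^ n) (u ^ n) 0 := by
    intro n
    induction n with
    | zero => intro a; simp
    | succ n ih =>
      have := ih.mul hg
      rw [pow_succ, pow_succ]
      simpa [mul_comm] using this
  have := h N
  rw [hu] at this
  exact this.eq_one

lemma IsSubst.jac_pow (Ω : VolumeForms A) {g : A ≃ₐ[ℂ] A} {u c : F} (hg : S.IsSubst g u c)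
    (n : ℕ) : Ω.jac (g ^ n) = Ω.jac g ^ n := by
  induction n with
  | zero => rw [pow_zero, pow_zero, Ω.jac_one]
  | succ n ih => rw [pow_succ', Ω.jac_mul, ih, map_pow, hg.apply_unit (Ω.isUnit_jac g), pow_succ]

variable [IsDomain A] [CharZero F]

lemma IsSubst.exists_jac_eq_of_scale (Ω : VolumeForms A) {g : A ≃ₐ[ℂ] A} {ζ : ℂ} {N : ℕ}
    [NeZero N] (hζ : IsPrimitiveRoot ζ N) (hg : S.IsSubst g (algebraMap ℂ F ζ) 0) :
    ∃ z : ℂ, Ω.jac g = algebraMap ℂ A z := by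
  have h1 : Ω.jac g ^ N = 1 := by
    rw [← hg.jac_pow, hg.pow_eq_one (by rw [← map_pow, hζ.pow_eq_one, map_one]), Ω.jac_one]
  have h2 := hζ.map_of_injective (FaithfulSMul.algebraMap_injective ℂ A)
  obtain ⟨i, -, hi⟩ := h2.eq_pow_of_pow_eq_one h1
  exact ⟨ζ ^ i, by rw [map_pow, hi]⟩

lemma IsSubst.exists_jac_eq_of_shift (Ω : VolumeForms A) {g : A ≃ₐ[ℂ] A} {c : F}
    (hg : S.IsSubst g 1 c) : ∃ z : ℂ, Ω.jac g = algebraMap ℂ A z := by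
  obtain ⟨s, hs⟩ := S.exists_isSubst_scale (z := -1) (by norm_num)
  have hsg := hs.mul hg
  have h1 : (s * g) ^ 2 = 1 := by
    have := hsg.mul hsg
    rw [← pow_two] at this
    simp only [map_neg, map_one] at this
    exact IsSubst.eq_one (by convert this using 1 <;> ring)
  have h2 : s ^ 2 = 1 := hs.pow_eq_one (by simp)
  have h3 : Ω.jac (s * g) = Ω.jac g * Ω.jac s := by
    rw [Ω.jac_mul, hs.apply_unit (Ω.isUnit_jac g)]
  have h4 := hsg.jac_pow Ω 2
  have h5 := hs.jac_pow Ω 2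
  rw [h1, Ω.jac_one, h3, mul_pow] at h4
  rw [h2, Ω.jac_one] at h5
  rw [← h5, mul_one] at h4
  rcases mul_self_eq_one_iff.1 ((pow_two _).symm.trans h4.symm) with h | h
  · exact ⟨1, by rw [h, map_one]⟩
  · exact ⟨-1, by rw [h, map_neg, map_one]⟩

variable (S)

/-- Naturality of the contraction propagates from degrees `-1` and `0` to all vector fields. -/
lemma naturality_eq_top [CharZero A] (hfg : Algebra.FiniteType ℂ A) (Ω : VolumeForms A)
    {g : A ≃ₐ[ℂ] A} (h1 : ∀ ξ, S.IsHomDer (-1) ξ → ξ ∈ Ω.naturality g)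
    (h0 : ∀ ξ, S.IsHomDer 0 ξ → ξ ∈ Ω.naturality g) (ξ : Derivation ℂ A A) :
    ξ ∈ Ω.naturality g := by
  have key : ∀ n : ℕ, ∀ ξ, S.IsHomDer n ξ → ξ ∈ Ω.naturality g := by
    intro n
    induction n with
    | zero => exact h0
    | succ n ih =>
      intro ξ hξ
      have e : ((n + 1 : ℕ) : A) • ξ =
          ∑ i, S.f i • ⁅S.ν i, ξ⁆ - ∑ i, ξ (S.f i) • S.ν i := by
        ext a
        have h2 := hξ a
        rw [S.euler_apply, S.euler_apply, map_sum] at h2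
        rw [Derivation.sub_apply, ← Derivation.coeFnAddMonoidHom_apply,
          ← Derivation.coeFnAddMonoidHom_apply, ← Derivation.coeFnAddMonoidHom_apply, map_sum,
          map_sum, Finset.sum_apply, Finset.sum_apply]
        simp only [Derivation.coeFnAddMonoidHom_apply, Derivation.smul_apply, smul_eq_mul,
          Derivation.commutator_apply, mul_sub, Finset.sum_sub_distrib, Derivation.leibniz,
          Finset.sum_add_distrib] at h2 ⊢
        simp only [mul_comm (ξ (S.f _))]
        push_cast at h2 ⊢
        linear_combination -h2
      refine Ω.mem_naturality_of_smul (a := ((n + 1 : ℕ) : A)) (by exact_mod_cast n.succ_ne_zero) ?_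
      rw [e]
      refine Submodule.sub_mem _ (Submodule.sum_mem _ fun i _ => Submodule.smul_mem _ _ (ih _ ?_))
        (Submodule.sum_mem _ fun i _ => Submodule.smul_mem _ _ (h1 _ (S.isHomDer_ν i)))
      have := (S.isHomDer_ν i).lie hξ
      rwa [show -1 + ((n + 1 : ℕ) : ℤ) = n by push_cast; ring] at this
  obtain ⟨T, c, hc, rfl, -⟩ := S.exists_sum_isHomDer hfg ξ
  refine Submodule.sum_mem _ fun m hm => ?_
  rcases lt_trichotomy m (-1) with h | rfl | h
  · rw [IsHomDer.eq_zero S (hc m hm) h]; exact Submodule.zero_mem _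
  · exact h1 _ (hc _ hm)
  · obtain ⟨n, rfl⟩ := Int.eq_ofNat_of_zero_le (by omega : 0 ≤ m)
    exact key n _ (hc _ hm)

lemma commute_of_forall_isHom {g : A ≃ₐ[ℂ] A} {ξ : Derivation ℂ A A}
    (h : ∀ (n : ℕ) (a : A), S.IsHom n a → ξ (g a) = g (ξ a)) (a : A) : ξ (g a) = g (ξ a) := by
  induction a using S.hom_induction with
  | zero => simp
  | add a b ha hb => simp only [map_add, ha, hb]
  | hom n a ha => exact h n a ha

lemma exists_f_ne_zero : ∃ i, S.f i ≠ 0 := by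
  obtain ⟨i, hu, -⟩ := S.exists_uv_ne_zero
  refine ⟨i, fun h => ?_⟩
  have := S.j_f i
  rw [h, map_zero] at this
  simp [hu] at this

lemma naturality_scale [CharZero A] (hfg : Algebra.FiniteType ℂ A) (Ω : VolumeForms A)
    {g : A ≃ₐ[ℂ] A} {z : ℂ} (hg : S.IsSubst g (algebraMap ℂ F z) 0) (ξ : Derivation ℂ A A) :
    ξ ∈ Ω.naturality g := by
  have h0 : ∀ ξ, S.IsHomDer 0 ξ → ξ ∈ Ω.naturality g := fun ξ hξ =>
    Ω.mem_naturality_of_commute <| S.commute_of_forall_isHom fun n a ha => by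
      have : S.IsHom n (ξ a) := by simpa using hξ.apply ha
      rw [hg.apply_of_isHom ha, hg.apply_of_isHom this, Derivation.map_smul]
  refine S.naturality_eq_top hfg Ω (fun ξ hξ => ?_) h0 ξ
  obtain ⟨i, hi⟩ := S.exists_f_ne_zero
  exact Ω.mem_naturality_of_smul hi (h0 _ (by simpa using IsHomDer.smul (S.isHom_f i) hξ))

lemma naturality_shift [CharZero A] (hfg : Algebra.FiniteType ℂ A) (Ω : VolumeForms A)
    {ν : Derivation ℂ A A} (hν1 : S.IsHomDer (-1) ν) {c : F}
    (hν : ∀ a, S.j (ν a) = C c * derivative (S.j a)) {g : A ≃ₐ[ℂ] A}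
    (hg : S.IsSubst g 1 c) (ξ : Derivation ℂ A A) : ξ ∈ Ω.naturality g := by
  have h1 : ∀ ξ, S.IsHomDer (-1) ξ → ξ ∈ Ω.naturality g := by
    intro ξ hξ
    obtain ⟨e, he⟩ := IsHomDer.exists_j_eq S hξ
    refine Ω.mem_naturality_of_commute fun a => S.j_injective ?_
    rw [he, hg, hg, he, mul_comp, C_comp, derivative_comp]
    simp
  refine S.naturality_eq_top hfg Ω h1 (fun ξ hξ => ?_) ξ
  obtain ⟨i, hu, -⟩ := S.exists_uv_ne_zero
  by_cases hc : c = 0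
  · have : g = 1 := IsSubst.eq_one (by rwa [hc] at hg)
    subst this
    exact Ω.mem_naturality_of_commute fun a => rfl
  have hr0 : ν (S.f i) ≠ 0 := by
    intro h
    have := hν (S.f i)
    rw [h, S.j_f] at this
    simp [hc, hu] at this
  have hrh : S.IsHom 0 (ν (S.f i)) := by simpa using hν1.apply (S.isHom_f i)
  have hlie : S.IsHomDer (-1) ⁅ν, ξ⁆ := by simpa using hν1.lie hξ
  have hlie2 : ⁅ν, ⁅ν, ξ⁆⁆ = 0 := IsHomDer.eq_zero S (hν1.lie hlie) (by norm_num)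
  have hνr : ν (ν (S.f i)) = 0 := IsHomDer.apply_zero S hν1 (by norm_num) hrh
  set η : Derivation ℂ A A := ν (S.f i) • ξ - S.f i • ⁅ν, ξ⁆ with hη
  have hηh : S.IsHomDer 0 η := by
    refine IsHomDer.sub ?_ ?_
    · simpa using IsHomDer.smul hrh hξ
    · simpa using IsHomDer.smul (S.isHom_f i) hlie
  have hcomm : ∀ a, η (ν a) = ν (η a) := by
    intro a
    have h2 := congrArg (fun ζ : Derivation ℂ A A => ζ a) hlie2
    simp only [Derivation.commutator_apply, Derivation.zero_apply] at h2
    simp only [hη, Derivation.sub_apply, Derivation.smul_apply, smul_eq_mul, map_sub,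
      Derivation.leibniz, hνr, Derivation.commutator_apply] 
    simp only [map_sub] at h2
    linear_combination (S.f i) * h2
  have hiter : ∀ (l : ℕ) a, η (ν^[l] a) = ν^[l] (η a) := fun l a =>
    (Function.Commute.iterate_right (f := η) (g := ν) hcomm l) a
  have hgη : η ∈ Ω.naturality g :=
    Ω.mem_naturality_of_commute <| S.commute_of_forall_isHom fun n a ha => by
      have hηa : S.IsHom n (η a) := by simpa using hηh.apply ha
      have e : ∀ a, S.IsHom n a →
          g a = ∑ l ∈ Finset.range (n + 1), (l.factorial : ℂ)⁻¹ • ν^[l] a := fun a ha =>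
        S.j_injective (by rw [hg, S.j_sum_iterate hν ha])
      rw [e a ha, e _ hηa, map_sum]
      simp only [Derivation.map_smul, hiter]
  refine Ω.mem_naturality_of_smul hr0 ?_
  rw [show ν (S.f i) • ξ = η + S.f i • ⁅ν, ξ⁆ by rw [hη, sub_add_cancel]]
  exact Submodule.add_mem _ hgη (Submodule.smul_mem _ _ (h1 _ hlie))

end AffineFrame

lemma VolumeForms.div_smul {A : Type*} [CommRing A] [Algebra ℂ A] (Ω : VolumeForms A) (z : ℂ)
    (ξ : Derivation ℂ A A) : Ω.div (z • ξ) = z • Ω.div ξ := by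
  apply Ω.smul_vol_injective
  rw [div_smul_vol, ← algebraMap_smul A z ξ, map_smul, LinearMap.smul_apply, algebraMap_smul,
    map_smul, ← div_smul_vol, smul_assoc]

namespace AffineFrame

variable {A : Type*} [CommRing A] [Algebra ℂ A] {F : Type*} [Field F] [Algebra ℂ F]
  {k : ℕ} {S : AffineFrame A F k}

lemma IsSubst.apply_of_isHom_int [CharZero F] {g : A ≃ₐ[ℂ] A} {z : ℂ}
    (hg : S.IsSubst g (algebraMap ℂ F z) 0) {n : ℤ} {a : A} (ha : S.IsHom n a) :
    g a = z ^ n • a := by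
  rcases lt_or_ge n 0 with h | h
  · rw [ha.eq_zero S h, map_zero, smul_zero]
  · obtain ⟨n, rfl⟩ := Int.eq_ofNat_of_zero_le h
    rw [hg.apply_of_isHom ha, zpow_natCast]

lemma IsSubst.conj_of_isHomDer [CharZero F] {g : A ≃ₐ[ℂ] A} {z : ℂ} (hz : z ≠ 0)
    (hg : S.IsSubst g (algebraMap ℂ F z) 0) {m : ℤ} {ξ : Derivation ℂ A A} (hξ : S.IsHomDer m ξ) :
    ξ.conj g = z ^ m • ξ := by
  ext a
  induction a using S.hom_induction with
  | zero => simp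
  | add a b ha hb => simp only [map_add, ha, hb]
  | hom n a ha =>
    have h1 : g.symm a = z ^ (-(n : ℤ)) • a := by
      rw [AlgEquiv.symm_apply_eq, map_smul, hg.apply_of_isHom_int ha, smul_smul, ← zpow_add₀ hz,
        neg_add_cancel, zpow_zero, one_smul]
    rw [Derivation.conj_apply, h1, Derivation.map_smul, map_smul,
      hg.apply_of_isHom_int (hξ.apply ha), smul_smul, ← zpow_add₀ hz, Derivation.smul_apply]
    congr 2; ring

variable (S)

lemma isHom_div [IsDomain A] [CharZero A] [CharZero F] (hfg : Algebra.FiniteType ℂ A) (Ω : VolumeForms A) {m : ℤ}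
    {ξ : Derivation ℂ A A} (hξ : S.IsHomDer m ξ) : S.IsHom m (Ω.div ξ) := by
  rw [isHom_iff]
  intro n hn
  set N := ((n : ℤ) - m).natAbs + 1 with hN
  have : NeZero N := ⟨by omega⟩
  have hζ := Complex.isPrimitiveRoot_exp N (by omega)
  set ζ := Complex.exp (2 * Real.pi * Complex.I / N)
  have hz : ζ ≠ 0 := hζ.ne_zero (by omega)
  obtain ⟨g, hg⟩ := S.exists_isSubst_scale hz
  obtain ⟨z, hzj⟩ := hg.exists_jac_eq_of_scale Ω hζ
  have h := Ω.div_conj (S.naturality_scale hfg Ω hg ξ) hzj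
  rw [hg.conj_of_isHomDer hz hξ, Ω.div_smul] at h
  have h1 := congrArg (fun a => (S.j a).coeff n) h
  simp only [map_smul, hg (Ω.div ξ), C_0, add_zero, comp_C_mul_X_coeff, coeff_smul] at h1
  rw [← algebraMap_smul F, smul_eq_mul, mul_comm] at h1
  by_contra hne
  have h2 : algebraMap ℂ F (ζ ^ m) = algebraMap ℂ F (ζ ^ n) := by
    rw [mul_left_cancel₀ hne h1, map_pow]
  have h3 : ζ ^ m = ζ ^ (n : ℤ) := by
    rw [zpow_natCast]; exact (algebraMap ℂ F).injective h2
  have h4 : ζ ^ ((n : ℤ) - m) = 1 := by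
    rw [zpow_sub₀ hz, h3, div_self (zpow_ne_zero _ hz)]
  rw [hζ.zpow_eq_one_iff_dvd] at h4
  have h5 := Int.eq_zero_of_abs_lt_dvd h4 (by rw [Int.abs_eq_natAbs]; omega)
  exact hn (by omega)

/-- Elements of filtration degree at most `n`. -/
def IsLE (n : ℤ) (a : A) : Prop := ∀ l : ℕ, n < l → (S.j a).coeff l = 0

variable {S}

lemma IsHom.isLE [CharZero F] {n m : ℤ} {a : A} (h : S.IsHom n a) (hnm : n ≤ m) : S.IsLE m a :=
  fun l hl => S.isHom_iff.1 h l (by omega)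

lemma IsLE.add {n : ℤ} {a b : A} (ha : S.IsLE n a) (hb : S.IsLE n b) : S.IsLE n (a + b) :=
  fun l hl => by rw [map_add, coeff_add, ha l hl, hb l hl, add_zero]

lemma IsLE.sub {n : ℤ} {a b : A} (ha : S.IsLE n a) (hb : S.IsLE n b) : S.IsLE n (a - b) :=
  fun l hl => by rw [map_sub, coeff_sub, ha l hl, hb l hl, sub_zero]

lemma IsLE.mono {n m : ℤ} {a : A} (ha : S.IsLE n a) (h : n ≤ m) : S.IsLE m a :=
  fun l hl => ha l (by omega)

lemma IsHomDer.isLE_apply [CharZero F] {m n : ℤ} {ξ : Derivation ℂ A A} (hξ : S.IsHomDer m ξ) {a : A}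
    (ha : S.IsLE n a) : S.IsLE (m + n) (ξ a) := by
  choose b hb using S.exists_component a
  have : a = ∑ l ∈ (S.j a).support, b l := by
    apply S.j_injective
    conv_lhs => rw [(S.j a).as_sum_support]
    rw [map_sum]
    exact Finset.sum_congr rfl fun l _ => (hb l).symm
  rw [this, map_sum]
  refine Finset.sum_induction _ (S.IsLE (m + n)) (fun _ _ => IsLE.add) (fun l _ => by simp) ?_
  intro l hl
  refine (hξ.apply (S.isHom_of_j_eq (hb l))).isLE ?_
  by_contra hlt
  exact mem_support_iff.1 hl (ha l (by omega))

lemma IsSubst.isLE_sub_sub {g : A ≃ₐ[ℂ] A} {ν : Derivation ℂ A A} {c : F}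
    (hν : ∀ a, S.j (ν a) = C c * derivative (S.j a)) (hg : S.IsSubst g 1 c) {n : ℤ} {a : A}
    (ha : S.IsLE n a) : S.IsLE (n - 2) (g a - a - ν a) := by
  intro l hl
  rw [map_sub, map_sub, hg, hν, C_1, one_mul, coeff_sub, coeff_sub, coeff_C_mul, coeff_derivative]
  have h1 : ((S.j a).comp (X + C c)).coeff l =
      (S.j a).coeff l + (S.j a).coeff (l + 1) * (l + 1) * c := by
    rw [← taylor_apply, taylor_coeff, hasseDeriv_apply, sum_def, eval_finset_sum]
    have hsub : ∀ i ∈ (S.j a).support, i ≤ l + 1 := by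
      intro i hi
      by_contra hlt
      exact mem_support_iff.1 hi (ha i (by omega))
    rw [Finset.sum_subset (s₂ := Finset.range (l + 2))
      (fun i hi => Finset.mem_range.2 (by have := hsub i hi; omega))
      (fun i _ hi => by rw [notMem_support_iff.1 hi]; simp), Finset.sum_range_succ,
      Finset.sum_range_succ, Finset.sum_eq_zero]
    · simp only [Nat.choose_succ_self_right, Nat.choose_self, monomial_eq_zero_iff, eval_monomial, Nat.cast_one, Nat.sub_self, add_tsub_cancel_left]
      push_cast; ring
    · intro i hi
      rw [Nat.choose_eq_zero_of_lt (Finset.mem_range.1 hi)]; simp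
  rw [h1]; ring

variable (S)

lemma div_lie [IsDomain A] [CharZero A] [CharZero F] (hfg : Algebra.FiniteType ℂ A) (Ω : VolumeForms A) {m : ℤ}
    {ν ξ : Derivation ℂ A A} (hν : S.IsHomDer (-1) ν) (hξ : S.IsHomDer m ξ) :
    Ω.div ⁅ν, ξ⁆ = ν (Ω.div ξ) := by
  obtain ⟨c, hc⟩ := IsHomDer.exists_j_eq S hν
  obtain ⟨g, hg⟩ := S.exists_isSubst_shift hc
  obtain ⟨z, hz⟩ := hg.exists_jac_eq_of_shift Ω
  have h := Ω.div_conj (S.naturality_shift hfg Ω hν hc hg ξ) hz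
  have hlie := hν.lie hξ
  have hL := S.isHom_div hfg Ω hlie
  have hR := hν.apply (S.isHom_div hfg Ω hξ)
  have hD := S.isHom_div hfg Ω hξ
  set η := ξ.conj g - ξ - ⁅ν, ξ⁆ with hη
  have hLE : ∀ n a, S.IsLE n a → S.IsLE (m - 2 + n) (η a) := by
    intro n a ha
    have hgs : S.IsSubst g.symm 1 (-c) := by
      intro a
      have := hg (g.symm a)
      rw [AlgEquiv.apply_symm_apply] at this
      rw [this, comp_assoc]
      simp
    have h1 := hgs.isLE_sub_sub (ν := -ν) (fun a => by simp [hc]) ha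
    have h2 : S.IsLE (n - 1) (g.symm a - a) := by
      have := (h1.mono (by omega : n - 2 ≤ n - 1)).sub
        ((hν.isLE_apply ha).mono (by omega : -1 + n ≤ n - 1))
      simpa using this
    have h3 : S.IsLE (m + n) (ξ (g.symm a)) := by
      have := hξ.isLE_apply ((h2.mono (by omega : n - 1 ≤ n)).add ha)
      rwa [sub_add_cancel] at this
    have h4 := hg.isLE_sub_sub hc h3
    have h5 := hξ.isLE_apply h1
    have h6 := hν.isLE_apply (hξ.isLE_apply h2)
    have e : η a = (g (ξ (g.symm a)) - ξ (g.symm a) - ν (ξ (g.symm a))) +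
        ξ (g.symm a - a - (-ν) a) + ν (ξ (g.symm a - a)) := by
      simp only [hη, Derivation.sub_apply, Derivation.conj_apply, Derivation.commutator_apply,
        Derivation.neg_apply, map_sub, map_neg]
      ring
    rw [e]
    exact ((h4.mono (by omega)).add (h5.mono (by omega))).add (h6.mono (by omega))
  obtain ⟨T, e, he, hsum, hT⟩ := S.exists_sum_isHomDer hfg η
  have hTm : ∀ t ∈ T, t ≤ m - 2 := by
    intro t ht
    obtain ⟨x, d, n, hx, hne, rfl⟩ := hT t ht
    by_contra hlt
    exact hne (hLE d x (hx.isLE le_rfl) n (by omega))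
  have hdη : S.IsLE (m - 2) (Ω.div η) := by
    rw [hsum, map_sum]
    exact Finset.sum_induction _ (S.IsLE (m - 2)) (fun _ _ => IsLE.add) (fun l _ => by simp)
      fun t ht => (S.isHom_div hfg Ω (he t ht)).isLE (hTm t ht)
  have hdg := hg.isLE_sub_sub hc (hD.isLE le_rfl)
  have hdiff : Ω.div ⁅ν, ξ⁆ - ν (Ω.div ξ) = (g (Ω.div ξ) - Ω.div ξ - ν (Ω.div ξ)) - Ω.div η := by
    rw [hη, map_sub, map_sub, h]; ring
  have h1 := hdg.sub hdη
  rw [← hdiff] at h1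
  have h2 := hL.sub hR
  rw [← sub_eq_zero]
  apply S.j_injective
  rw [map_zero]
  ext l
  by_cases hl : (l : ℤ) = -1 + m
  · exact h1 l (by omega)
  · exact S.isHom_iff.1 h2 l hl

end AffineFrame

namespace AffineFrame

variable {A : Type*} [CommRing A] [Algebra ℂ A] {F : Type*} [Field F] [Algebra ℂ F]
  {k : ℕ} (S : AffineFrame A F k)

lemma isLND_of_isHomDer [CharZero F] {ν : Derivation ℂ A A} (hν : S.IsHomDer (-1) ν) :
    IsLND ν := by
  have hadd : ∀ (a : A) (M N : ℕ), (ν.toLinearMap ^ N) a = 0 →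
      (ν.toLinearMap ^ (M + N)) a = 0 := by
    intro a M N h
    rw [pow_add, Module.End.mul_apply, h, map_zero]
  intro a
  induction a using S.hom_induction with
  | zero => exact ⟨0, by simp⟩
  | add a b ha hb =>
    obtain ⟨M, hM⟩ := ha
    obtain ⟨N, hN⟩ := hb
    exact ⟨M + N, by rw [map_add, hadd b M N hN, add_comm M, hadd a N M hM, add_zero]⟩
  | hom n a ha =>
    have key : ∀ l : ℕ, S.IsHom ((n : ℤ) - l) ((ν.toLinearMap ^ l) a) := by
      intro l
      induction l with
      | zero => simpa using ha
      | succ l ih =>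
        rw [pow_succ', Module.End.mul_apply]
        have := hν.apply ih
        rw [show ((n : ℤ) - (l + 1 : ℕ)) = -1 + (n - l) by push_cast; ring]
        exact this
    exact ⟨n + 1, (key (n + 1)).eq_zero S (by push_cast; omega)⟩

lemma exists_isHomDer_of_closed [IsDomain A] [CharZero A] [CharZero F]
    (hfg : Algebra.FiniteType ℂ A) (Ω : VolumeForms A)
    (c : LinearMap.ker Ω.d1 ⧸ (LinearMap.range Ω.d0).comap (LinearMap.ker Ω.d1).subtype) :
    ∃ (ν : Derivation ℂ A A) (hν : Ω.ι2 ν Ω.vol ∈ LinearMap.ker Ω.d1), S.IsHomDer (-1) ν ∧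
      Submodule.Quotient.mk (⟨Ω.ι2 ν Ω.vol, hν⟩ : LinearMap.ker Ω.d1) = c := by
  obtain ⟨⟨τ, hτ⟩, rfl⟩ := Submodule.Quotient.mk_surjective _ c
  obtain ⟨κ, rfl⟩ := Ω.theta_bij.2 τ
  have hκ : Ω.div κ = 0 := (Ω.div_eq_zero_iff κ).2 hτ
  let Θ : Derivation ℂ A A →ₗ[ℂ] Ω.F1 := (Ω.ι2.flip Ω.vol).restrictScalars ℂ
  have hΘ : ∀ ξ, Θ ξ = Ω.ι2 ξ Ω.vol := fun ξ => rfl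
  obtain ⟨ν, hν, hW⟩ := S.exists_sub_mem_of_map_eq_zero (D := Ω.div)
    (fun m ξ hξ => S.isHom_div hfg Ω hξ) (fun ν m ξ hν hξ => S.div_lie hfg Ω hν hξ) hfg
    ((LinearMap.range Ω.d0).comap Θ)
    (fun ν ξ _ hν hξ => by
      rw [Submodule.mem_comap, hΘ,
        Ω.cartan _ _ ((Ω.div_eq_zero_iff ν).1 hν) ((Ω.div_eq_zero_iff ξ).1 hξ)]
      exact LinearMap.mem_range_self _ _) hκ
  have hν0 : Ω.div ν = 0 := (S.isHom_div hfg Ω hν).eq_zero S (by norm_num)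
  refine ⟨ν, (Ω.div_eq_zero_iff ν).1 hν0, hν, ?_⟩
  symm
  rw [Submodule.Quotient.eq, Submodule.mem_comap]
  rw [Submodule.mem_comap, map_sub, hΘ, hΘ] at hW
  exact hW

end AffineFrame

section Charts

lemma span_range_eq_top_of_forall_algHom {R : Type*} [CommRing R] [Algebra ℂ R]
    (hfg : Algebra.FiniteType ℂ R) {ι : Type*} {α : ι → R}
    (h : ¬ ∃ q : R →ₐ[ℂ] ℂ, ∀ i, q (α i) = 0) : Ideal.span (Set.range α) = ⊤ := by
  by_contra hne
  obtain ⟨m, hm, hle⟩ := Ideal.exists_le_maximal _ hne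
  let := Ideal.Quotient.field m
  have : Algebra.FiniteType ℂ (R ⧸ m) :=
    hfg.of_surjective (Ideal.Quotient.mkₐ ℂ m) (Ideal.Quotient.mkₐ_surjective ℂ m)
  have hfin : Module.Finite ℂ (R ⧸ m) := finite_of_finite_type_of_isJacobsonRing ℂ (R ⧸ m)
  have hbij := IsAlgClosed.algebraMap_bijective_of_isIntegral (k := ℂ) (K := R ⧸ m)
  let e : ℂ ≃ₐ[ℂ] R ⧸ m := AlgEquiv.ofBijective (Algebra.ofId ℂ (R ⧸ m)) hbij
  refine h ⟨e.symm.toAlgHom.comp (Ideal.Quotient.mkₐ ℂ m), fun i => ?_⟩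
  have h1 : Ideal.Quotient.mk m (α i) = 0 :=
    Ideal.Quotient.eq_zero_iff_mem.2 (hle (Ideal.subset_span ⟨i, rfl⟩))
  simp [h1]

variable {A R : Type*} [CommRing A] [IsDomain A] [Algebra ℂ A] [CommRing R] [IsDomain R]
  [Algebra ℂ R] (πs : R →ₐ[ℂ] A)

lemma exists_chart {α : R} (hα : α ≠ 0)
    (e : Localization.Away (πs α) ≃+* Polynomial (Localization.Away α))
    (he : ∀ r : R, e (algebraMap A (Localization.Away (πs α)) (πs r)) =
      C (algebraMap R (Localization.Away α) r)) :
    ∃ j : A →+* (Localization.Away α)[X], Function.Injective j ∧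
      (∀ r, j (πs r) = C (algebraMap R (Localization.Away α) r)) ∧
      ∀ q, ∃ (n : ℕ) (a : A), j a = C (algebraMap R (Localization.Away α) α) ^ n * q := by
  have hinjR : Function.Injective (algebraMap R (Localization.Away α)) :=
    IsLocalization.injective _ (powers_le_nonZeroDivisors_of_noZeroDivisors hα)
  have hπα : πs α ≠ 0 := by
    intro h
    have h1 := he α
    rw [(congrArg (algebraMap A _) h).trans (map_zero _), map_zero, eq_comm, C_eq_zero] at h1
    exact hα (hinjR (by rw [h1, map_zero]))
  have hinjA : Function.Injective (algebraMap A (Localization.Away (πs α))) :=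
    IsLocalization.injective _ (powers_le_nonZeroDivisors_of_noZeroDivisors hπα)
  refine ⟨(e : Localization.Away (πs α) →+* _).comp (algebraMap A _), e.injective.comp hinjA, he,
    fun q => ?_⟩
  obtain ⟨n, a, h⟩ := IsLocalization.Away.surj (πs α) (e.symm q)
  refine ⟨n, a, ?_⟩
  have := congrArg e h
  rw [map_mul, map_pow, he, RingEquiv.apply_symm_apply] at this
  rw [mul_comm]
  exact this.symm

variable {πs}

lemma exists_derivation_of_chart (hfg : Algebra.FiniteType ℂ A) {L : Type*} [CommRing L]
    [Algebra R L] {α : R} {j : A →+* L[X]} (hj : Function.Injective j)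
    (hjπ : ∀ r, j (πs r) = C (algebraMap R L r))
    (hq : ∀ q, ∃ (n : ℕ) (a : A), j a = C (algebraMap R L α) ^ n * q) :
    ∃ (ν : Derivation ℂ A A) (M : ℕ), ∀ a,
      j (ν a) = C (algebraMap R L α) ^ M * derivative (j a) := by
  obtain ⟨G, hG⟩ := hfg.out
  choose n a ha using hq
  set M := G.sup fun x => n (derivative (j x)) with hM
  have hconst : ∀ z : ℂ, derivative (j (algebraMap ℂ A z)) = 0 := by
    intro z
    rw [← πs.commutes, hjπ, derivative_C]
  have key : ∀ x, ∃ y, j y = C (algebraMap R L α) ^ M * derivative (j x) := by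
    intro x
    have hx : x ∈ Algebra.adjoin ℂ (G : Set A) := hG ▸ Algebra.mem_top
    induction hx using Algebra.adjoin_induction with
    | mem x hx =>
      have hle : n (derivative (j x)) ≤ M := Finset.le_sup (f := fun x => n (derivative (j x))) hx
      refine ⟨πs α ^ (M - n (derivative (j x))) * a (derivative (j x)), ?_⟩
      rw [map_mul, map_pow, hjπ, ha, ← mul_assoc, ← pow_add, Nat.sub_add_cancel hle]
    | algebraMap z => exact ⟨0, by rw [hconst]; simp⟩
    | add x y _ _ hx hy =>
      obtain ⟨x', hx⟩ := hx
      obtain ⟨y', hy⟩ := hy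
      exact ⟨x' + y', by rw [map_add, hx, hy, map_add, map_add, mul_add]⟩
    | mul x y _ _ hx hy =>
      obtain ⟨x', hx⟩ := hx
      obtain ⟨y', hy⟩ := hy
      exact ⟨x' * y + x * y', by
        rw [map_add, map_mul, map_mul, hx, hy, map_mul, derivative_mul]; ring⟩
  choose b hb using key
  refine ⟨Derivation.mk'
    { toFun := b
      map_add' := fun x y => hj (by rw [map_add, hb, hb, hb, map_add, map_add, mul_add])
      map_smul' := fun z x => hj (by
        rw [RingHom.id_apply, hb, Algebra.smul_def, Algebra.smul_def, map_mul j, map_mul j,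
          derivative_mul, hconst, hb]; ring) }
    fun x y => hj ?_, M, hb⟩
  simp only [LinearMap.coe_mk, AddHom.coe_mk, smul_eq_mul, map_add, map_mul, hb, derivative_mul]
  ring

lemma exists_derivation_apply_eq (hfg : Algebra.FiniteType ℂ A) {α : R}
    (h : ∃ e : Localization.Away (πs α) ≃+* Polynomial (Localization.Away α),
      ∀ r : R, e (algebraMap A (Localization.Away (πs α)) (πs r)) =
        C (algebraMap R (Localization.Away α) r)) :
    ∃ (ν : Derivation ℂ A A) (y : A) (M : ℕ), (∀ r, ν (πs r) = 0) ∧ ν y = πs (α ^ M) ∧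
      (α = 0 → ν = 0 ∧ y = 0) := by
  by_cases hα : α = 0
  · exact ⟨0, 0, 1, by simp, by simp [hα], fun _ => ⟨rfl, rfl⟩⟩
  obtain ⟨e, he⟩ := h
  obtain ⟨j, hj, hjπ, hq⟩ := exists_chart πs hα e he
  obtain ⟨ν, M, hν⟩ := exists_derivation_of_chart hfg hj hjπ hq
  obtain ⟨N, y, hy⟩ := hq X
  refine ⟨ν, y, M + N, fun r => hj ?_, hj ?_, fun h => absurd h hα⟩
  · rw [hν, hjπ, derivative_C, mul_zero, map_zero]
  · rw [hν, hy, hjπ, map_pow, C_pow, ← C_pow, ← C_pow, ← C_pow, derivative_C_mul, derivative_X,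
      mul_one, ← C_mul, ← pow_add]

lemma exists_embedding {α : R} (hα : α ≠ 0)
    (h : ∃ e : Localization.Away (πs α) ≃+* Polynomial (Localization.Away α),
      ∀ r : R, e (algebraMap A (Localization.Away (πs α)) (πs r)) =
        C (algebraMap R (Localization.Away α) r)) :
    ∃ φ : A →+* (FractionRing R)[X], Function.Injective φ ∧
      (∀ r, φ (πs r) = C (algebraMap R (FractionRing R) r)) ∧
      ∃ (y : A) (β : FractionRing R), β ≠ 0 ∧ φ y = C β * X := by
  obtain ⟨e, he⟩ := h
  obtain ⟨j, hj, hjπ, hq⟩ := exists_chart πs hα e he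
  have hα' : algebraMap R (FractionRing R) α ≠ 0 := by
    simpa using hα
  let ψ : Localization.Away α →+* FractionRing R :=
    IsLocalization.Away.lift α (IsUnit.mk0 _ hα')
  have hψ : ∀ r, ψ (algebraMap R _ r) = algebraMap R _ r :=
    IsLocalization.Away.lift_eq α _
  have hψi : Function.Injective ψ := by
    rw [injective_iff_map_eq_zero]
    intro x hx
    obtain ⟨n, a, ha⟩ := IsLocalization.Away.surj α x
    have h1 := congrArg ψ ha
    rw [map_mul, hx, zero_mul, hψ, eq_comm, FaithfulSMul.algebraMap_eq_zero_iff] at h1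
    rw [h1, map_zero] at ha
    exact (((IsLocalization.Away.algebraMap_isUnit α).pow n).mul_left_eq_zero).1 ha
  refine ⟨(mapRingHom ψ).comp j, (map_injective ψ hψi).comp hj, fun r => ?_, ?_⟩
  · rw [RingHom.comp_apply, hjπ, coe_mapRingHom, map_C, hψ]
  · obtain ⟨n, y, hy⟩ := hq X
    refine ⟨y, algebraMap R _ α ^ n, pow_ne_zero _ hα', ?_⟩
    rw [RingHom.comp_apply, hy, coe_mapRingHom, Polynomial.map_mul, Polynomial.map_pow, map_C,
      map_X, hψ, C_pow]

lemma derivation_eval₂ {ν : Derivation ℂ A A} (hν : ∀ r, ν (πs r) = 0) (y : A) (q : R[X]) :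
    ν (q.eval₂ (πs : R →+* A) y) = (derivative q).eval₂ (πs : R →+* A) y * ν y := by
  induction q using Polynomial.induction_on' with
  | add p q hp hq => simp only [eval₂_add, map_add, hp, hq, add_mul]
  | monomial n r =>
    rw [eval₂_monomial, derivative_monomial, eval₂_monomial, Derivation.leibniz,
      Derivation.leibniz_pow]
    simp only [RingHom.coe_coe, hν, smul_zero, add_zero, smul_eq_mul, nsmul_eq_mul, map_mul,
      map_natCast]
    ring

/-- A vertical vector field is a multiple of `d/dX`. -/
lemma exists_eq_mul_derivative {φ : A →+* (FractionRing R)[X]} (hφ : Function.Injective φ)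
    (hφπ : ∀ r, φ (πs r) = C (algebraMap R (FractionRing R) r)) {y : A} {β : FractionRing R}
    (hβ : β ≠ 0) (hy : φ y = C β * X) {ν : Derivation ℂ A A} (hν : ∀ r, ν (πs r) = 0) :
    ∃ p, ∀ a, φ (ν a) = p * derivative (φ a) := by
  refine ⟨C β⁻¹ * φ (ν y), fun a => ?_⟩
  have hev : ∀ q : R[X], φ (q.eval₂ (πs : R →+* A) y) =
      (q.map (algebraMap R (FractionRing R))).comp (C β * X) := by
    intro q
    induction q using Polynomial.induction_on' with
    | add p q hp hq => simp only [eval₂_add, map_add, hp, hq, Polynomial.map_add, add_comp]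
    | monomial n r =>
      rw [eval₂_monomial, map_monomial, ← C_mul_X_pow_eq_monomial, map_mul, map_pow, hy,
        RingHom.coe_coe, hφπ]
      simp
  obtain ⟨b, hb⟩ := IsLocalization.integerNormalization_map_to_map (nonZeroDivisors R)
    ((φ a).comp (C β⁻¹ * X))
  set q := IsLocalization.integerNormalization (nonZeroDivisors R) ((φ a).comp (C β⁻¹ * X))
  have hββ : C β⁻¹ * C β = (1 : (FractionRing R)[X]) := by
    rw [← C_mul, inv_mul_cancel₀ hβ, C_1]
  have hq : (q.map (algebraMap R (FractionRing R))).comp (C β * X) =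
      C (algebraMap R (FractionRing R) b) * φ a := by
    have : (C β⁻¹ * X).comp (C β * X) = (X : (FractionRing R)[X]) := by
      rw [mul_comp, C_comp, X_comp, ← mul_assoc, hββ, one_mul]
    rw [hb, ← algebraMap_smul (FractionRing R), smul_comp, comp_assoc, this, comp_X,
      smul_eq_C_mul]
  have h1 : πs b * a = q.eval₂ (πs : R →+* A) y := hφ (by rw [map_mul, hφπ, hev, hq])
  have h2 := congrArg (fun x => φ (ν x)) h1
  simp only [derivation_eval₂ hν, Derivation.leibniz, hν, smul_zero, mul_zero, add_zero,
    smul_eq_mul, map_mul, hφπ, hev] at h2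
  have h3 := congrArg derivative hq
  rw [derivative_comp, derivative_C_mul, derivative_C_mul, derivative_X, mul_one, derivative_map]
    at h3
  have hb0 : C (algebraMap R (FractionRing R) b) ≠ 0 := by
    have := nonZeroDivisors.coe_ne_zero b
    simpa using this
  apply mul_left_cancel₀ hb0
  linear_combination h2 + C β⁻¹ * φ (ν y) * h3 -
    (((derivative q).map (algebraMap R (FractionRing R))).comp (C β * X)) * φ (ν y) * hββ

end Charts

section Frame

lemma Polynomial.exists_eq_of_derivative_eq_C {F : Type*} [Field F] [CharZero F] {p : F[X]} {u : F}
    (h : derivative p = C u) : ∃ c, p = C u * X + C c := by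
  refine ⟨p.coeff 0, ?_⟩
  have h1 : derivative (p - C u * X) = 0 := by
    rw [derivative_sub, h, derivative_C_mul, derivative_X, mul_one, sub_self]
  have h2 := eq_C_of_derivative_eq_zero h1
  rw [coeff_sub, coeff_C_mul, coeff_X_zero, mul_zero, sub_zero] at h2
  rw [← h2]; ring

variable {A R : Type*} [CommRing A] [IsDomain A] [Algebra ℂ A] [CommRing R] [IsDomain R]
  [Algebra ℂ R] {πs : R →ₐ[ℂ] A}

lemma exists_affineFrame (hfg : Algebra.FiniteType ℂ A) {k : ℕ} {α : Fin k → R}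
    (hα : Ideal.span (Set.range α) = ⊤)
    (htriv : ∀ i, ∃ e : Localization.Away (πs (α i)) ≃+* Polynomial (Localization.Away (α i)),
      ∀ r : R, e (algebraMap A (Localization.Away (πs (α i))) (πs r)) =
        C (algebraMap R (Localization.Away (α i)) r)) :
    ∃ S : AffineFrame A (FractionRing R) k, ∀ r, S.j (πs r) = C (algebraMap R _ r) := by
  have : CharZero (FractionRing R) := charZero_of_injective_algebraMap (algebraMap ℂ (FractionRing R)).injective
  obtain ⟨i₀, hi₀⟩ : ∃ i, α i ≠ 0 := by
    by_contra! h
    rw [show α = 0 from funext h] at hα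
    have : Ideal.span (Set.range (0 : Fin k → R)) ≤ ⊥ := by
      rw [Ideal.span_le]; rintro _ ⟨i, rfl⟩; simp
    rw [hα, top_le_iff] at this
    exact bot_ne_top this
  obtain ⟨φ, hφ, hφπ, y₀, β, hβ, hy₀⟩ := exists_embedding hi₀ (htriv i₀)
  choose ν y M hνπ hνy hzero using fun i => exists_derivation_apply_eq hfg (htriv i)
  have hloc : ∀ i, ∃ u v c, (∀ a, φ (ν i a) = C v * derivative (φ a)) ∧
      φ (y i) = C u * X + C c ∧ u * v = algebraMap R (FractionRing R) (α i ^ M i) := by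
    intro i
    obtain ⟨p, hp⟩ := exists_eq_mul_derivative hφ hφπ hβ hy₀ (hνπ i)
    by_cases hi : α i = 0
    · obtain ⟨hν0, hy0⟩ := hzero i hi
      refine ⟨0, 0, 0, by simp [hν0], by simp [hy0], ?_⟩
      have h := hνy i
      rw [hν0, Derivation.zero_apply, hi] at h
      have hM : M i ≠ 0 := by
        intro hM
        rw [hM, pow_zero, map_one] at h
        exact zero_ne_one h
      rw [hi, zero_pow hM, map_zero, mul_zero]
    have h1 : p * derivative (φ (y i)) = C (algebraMap R (FractionRing R) (α i ^ M i)) := by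
      rw [← hp, hνy, hφπ]
    have h2 : IsUnit (p * derivative (φ (y i))) := by
      rw [h1, isUnit_C]
      exact IsUnit.mk0 _ (by simpa using pow_ne_zero _ hi)
    obtain ⟨v, -, hv⟩ := isUnit_iff.1 (isUnit_of_mul_isUnit_left h2)
    obtain ⟨u, -, hu⟩ := isUnit_iff.1 (isUnit_of_mul_isUnit_right h2)
    obtain ⟨c, hc⟩ := exists_eq_of_derivative_eq_C hu.symm
    refine ⟨u, v, c, fun a => by rw [hp, hv], hc, ?_⟩
    rw [← hv, ← hu, ← C_mul, mul_comm] at h1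
    exact C_injective h1
  choose u v c hνφ hyφ huv using hloc
  obtain ⟨r, hr⟩ : ∃ r : Fin k → R, ∑ i, r i * α i ^ M i = 1 := by
    have h1 : Ideal.span (Set.range fun i => α i ^ M i) = ⊤ := by
      choose i hi using fun x : Set.range α => x.2
      rw [eq_top_iff, ← Ideal.span_range_pow_eq_top _ hα fun x => M (i x), Ideal.span_le]
      rintro _ ⟨x, rfl⟩
      exact Ideal.subset_span ⟨i x, by simp only [hi]⟩
    have h2 := (Ideal.eq_top_iff_one _).1 h1
    rw [Ideal.mem_span_range_iff_exists_fun] at h2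
    exact h2
  have hsum : ∑ i, algebraMap R (FractionRing R) (r i) * (u i * v i) = 1 := by
    simp only [huv, ← map_mul, ← map_sum, hr, map_one]
  let E₀ : Derivation ℂ A A := ∑ i, (πs (r i) * y i) • ν i
  set c₀ := ∑ i, algebraMap R (FractionRing R) (r i) * (c i * v i) with hc₀
  have hE₀ : ∀ a, φ (E₀ a) = (X + C c₀) * derivative (φ a) := by
    intro a
    have h1 : E₀ a = ∑ i, πs (r i) * y i * ν i a := by
      simp only [E₀, ← Derivation.coeFnAddMonoidHom_apply, map_sum, Finset.sum_apply]
      rfl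
    rw [h1, map_sum]
    calc _ = ∑ i, (C (algebraMap R (FractionRing R) (r i) * (u i * v i)) * (X * derivative (φ a)) +
          C (algebraMap R (FractionRing R) (r i) * (c i * v i)) * derivative (φ a)) := by
            refine Finset.sum_congr rfl fun i _ => ?_
            rw [map_mul, map_mul, hφπ, hyφ, hνφ]
            simp only [C_mul]; ring
      _ = _ := by
            rw [Finset.sum_add_distrib, ← Finset.sum_mul, ← Finset.sum_mul, ← map_sum, ← map_sum,
              hsum, ← hc₀, C_1]
            ring
  let j : A →ₐ[ℂ] (FractionRing R)[X] :=
    { (compRingHom (X - C c₀)).comp φ with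
      commutes' := fun z => by
        change (φ (algebraMap ℂ A z)).comp (X - C c₀) = _
        rw [← πs.commutes, hφπ, C_comp, ← IsScalarTower.algebraMap_apply]
        rfl }
  have hj : ∀ a, j a = (φ a).comp (X - C c₀) := fun a => rfl
  have hjd : ∀ a, derivative (j a) = (derivative (φ a)).comp (X - C c₀) := by
    intro a
    rw [hj, derivative_comp, derivative_sub, derivative_X, derivative_C, sub_zero, one_mul]
  have hjE : ∀ a, j (E₀ a) = X * derivative (j a) := by
    intro a
    rw [hj, hE₀, mul_comp, hjd, add_comp, X_comp, C_comp, sub_add_cancel]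
  refine ⟨
    { j := j
      j_injective := ?_
      f := fun i => E₀ (πs (r i) * y i)
      ν := ν
      u := fun i => algebraMap R (FractionRing R) (r i) * u i
      v := v
      j_f := ?_
      j_ν := ?_
      sum_uv := by simpa only [mul_assoc] using hsum }, ?_⟩
  · intro a b hab
    apply hφ
    have h1 : ((φ a).comp (X - C c₀)).comp (X + C c₀) = ((φ b).comp (X - C c₀)).comp (X + C c₀) :=
      congrArg (fun p => comp p (X + C c₀)) hab
    simpa [comp_assoc] using h1
  · intro i
    rw [hjE, hjd, map_mul, hφπ, hyφ, derivative_C_mul]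
    simp only [derivative_add, derivative_C_mul, derivative_X, derivative_C, mul_one, add_zero,
      mul_comp, C_comp, C_mul]
    ring
  · intro i a
    rw [hj, hνφ, mul_comp, C_comp, hjd]
  · intro r
    change j (πs r) = _
    rw [hj, hφπ, C_comp]

end Frame

end

theorem statement10 (A R : Type) [CommRing A] [IsDomain A] [Algebra ℂ A]
    [CommRing R] [IsDomain R] [Algebra ℂ R]
    (hfgA : Algebra.FiniteType ℂ A) (hsmA : Algebra.FormallySmooth ℂ A)
    (hfgR : Algebra.FiniteType ℂ R) (hsmR : Algebra.FormallySmooth ℂ R)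
    (πs : R →ₐ[ℂ] A)
    -- p is a Zariski locally trivial 𝔸¹-fibration:
    (k : ℕ) (α : Fin k → R)
    (hnocommonzero : ¬ ∃ q : R →ₐ[ℂ] ℂ, ∀ i, q (α i) = 0)
    (htriv : ∀ i, ∃ e : Localization.Away (πs (α i)) ≃+*
        Polynomial (Localization.Away (α i)),
      ∀ r : R, e (algebraMap A (Localization.Away (πs (α i))) (πs r)) =
        Polynomial.C (algebraMap R (Localization.Away (α i)) r))
    -- the volume form and the algebraic de Rham data on X
    (Ω : VolumeForms A) :
    -- every algebraic de Rham cohomology class of degree n-1 is represented by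
    -- Θ(ν) = ι_ν ω for a locally nilpotent ν tangent to the fibers of p
    ∀ c : (↥(LinearMap.ker Ω.d1) ⧸
        ((LinearMap.range Ω.d0).comap (LinearMap.ker Ω.d1).subtype)),
      ∃ (ν : Derivation ℂ A A) (hν : Ω.ι2 ν Ω.vol ∈ LinearMap.ker Ω.d1),
        IsLND ν ∧ (∀ r : R, ν (πs r) = 0) ∧
        Submodule.Quotient.mk (⟨Ω.ι2 ν Ω.vol, hν⟩ : ↥(LinearMap.ker Ω.d1)) = c := by
  intro c
  have : CharZero A := charZero_of_injective_algebraMap (FaithfulSMul.algebraMap_injective ℂ A)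
  have : CharZero (FractionRing R) :=
    charZero_of_injective_algebraMap (algebraMap ℂ (FractionRing R)).injective
  obtain ⟨S, hS⟩ := exists_affineFrame hfgA
    (span_range_eq_top_of_forall_algHom hfgR hnocommonzero) htriv
  obtain ⟨ν, hclosed, hν, hc⟩ := S.exists_isHomDer_of_closed hfgA Ω c
  exact ⟨ν, hclosed, S.isLND_of_isHomDer hν, fun r => AffineFrame.IsHomDer.apply_zero S hν
    (by norm_num) (S.isHom_of_j_eq (m := 0) (hS r)), hc⟩
end
end

section
/- Let X and B be smooth affine algebraic varieties and π: X → B a Zariski locally trivial fibration with fiber Y admitting a nontrivial locally nilpotent vector field δ. Let α₁, …, α_k be regular functions on B without common zeros such that X_i := X \ (α_i ∘ π)^{-1}(0) is naturally isomorphic to B_i × Y where B_i = B \ α_i^{-1}(0). Suppose ξ₁, …, ξ_k are locally nilpotent vector fields on X such that: (i) ξ_i(ℂ[B]) ⊆ ℂ[B], i.e. ξ_i induces a locally nilpotent vector field ξ_i′ on B; (ii) α_i ∈ Ker ξ_i′; (iii) ξ_i′ admits a slice on B_i (B_i ≅ R_i × ℂ with the ℂ₊-action a translation on the second factor). Then there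 exist a nontrivial locally nilpotent vector field η on X and a nonzero ideal J ⊆ ℂ[X] with J·η ⊆ Lie_alg(X). -/
/-!
STATEMENT 13 (Corollary `ap2`): Let X and B be smooth affine algebraic varieties and
π : X → B a Zariski locally trivial fibration with fiber Y admitting a nontrivial locally
nilpotent vector field δ.  Let α₁, …, α_k be regular functions on B without common zeros
such that X_i := X \ (α_i ∘ π)⁻¹(0) is naturally isomorphic to B_i × Y where
B_i = B \ α_i⁻¹(0).  Suppose ξ₁, …, ξ_k are locally nilpotent vector fields on X such
that (i) ξ_i(ℂ[B]) ⊆ ℂ[B], inducing ξ_i′ on B; (ii) α_i ∈ Ker ξ_i′; (iii) ξ_i′ admits a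
slice on B_i.  Then there exist a nontrivial locally nilpotent vector field η on X and a
nonzero ideal J ⊆ ℂ[X] with J·η ⊆ Lie_alg(X).

Modelling conventions: X, B, Y have coordinate rings `A`, `R`, `CY`; π is given by the
comorphism `πs : R →ₐ[ℂ] A`.  The trivialization X_i ≅ B_i × Y is an isomorphism of the
localization `A[1/πs(α_i)]` with `R[1/α_i] ⊗ ℂ[Y]` over B_i (a ring isomorphism carrying
the image of ℂ[B] to the first tensor factor).  A slice of ξ_i′ on B_i is an element s of
`R[1/α_i]` with ξ_i′(s) = 1; equivalently (clearing denominators) an element r ∈ R with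
ξ_i′ r = α_i ^ m for some m -- this is how (iii) is encoded.
-/

noncomputable section

open scoped TensorProduct

def IsCompleteField {A : Type*} [CommRing A] [Algebra ℂ A] (ξ : Derivation ℂ A A) : Prop :=
  ∀ p : A →ₐ[ℂ] ℂ, ∃ γ : ℂ → (A →ₐ[ℂ] ℂ), γ 0 = p ∧
    ∀ (a : A) (t : ℂ), HasDerivAt (fun s => (γ s) a) ((γ t) (ξ a)) t

def LieAlgGen (A : Type*) [CommRing A] [Algebra ℂ A] : LieSubalgebra ℂ (Derivation ℂ A A) :=
  LieSubalgebra.lieSpan ℂ (Derivation ℂ A A) {ξ | IsCompleteField ξ}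

section LocallyNilpotent

variable {A : Type*} [CommRing A] [Algebra ℂ A]

lemma Derivation.pow_apply_eq_zero_of_le {ξ : Derivation ℂ A A} {a : A} {m n : ℕ} (h : m ≤ n)
    (ha : (ξ.toLinearMap ^ m) a = 0) : (ξ.toLinearMap ^ n) a = 0 := by
  obtain ⟨k, rfl⟩ := Nat.exists_eq_add_of_le' h
  rw [pow_add, Module.End.mul_apply, ha, map_zero]

/-- The formal flow `∑ p(ξⁿ a) Xⁿ / n!` of a derivation through the point `p`. -/
def formalFlow (ξ : Derivation ℂ A A) (p : A →ₐ[ℂ] ℂ) : A →ₗ[ℂ] PowerSeries ℂ where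
  toFun a := PowerSeries.mk fun n => p ((ξ.toLinearMap ^ n) a) / (n.factorial : ℂ)
  map_add' a b := by ext n; simp [add_div]
  map_smul' c a := by ext n; simp [mul_div_assoc]

lemma derivative_formalFlow (ξ : Derivation ℂ A A) (p : A →ₐ[ℂ] ℂ) (a : A) :
    PowerSeries.derivative ℂ (formalFlow ξ p a) = formalFlow ξ p (ξ a) := by
  ext n
  have h : ((n : ℂ) + 1) ≠ 0 := Nat.cast_add_one_ne_zero n
  have h' : (n.factorial : ℂ) ≠ 0 := by exact_mod_cast n.factorial_ne_zero
  rw [PowerSeries.coeff_derivative]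
  simp only [formalFlow, LinearMap.coe_mk, AddHom.coe_mk, PowerSeries.coeff_mk, pow_succ,
    Module.End.mul_apply, Derivation.coeFn_coe, Nat.factorial_succ, Nat.cast_mul, Nat.cast_add,
    Nat.cast_one]
  field_simp

lemma formalFlow_mul (ξ : Derivation ℂ A A) (p : A →ₐ[ℂ] ℂ) (a b : A) :
    formalFlow ξ p (a * b) = formalFlow ξ p a * formalFlow ξ p b := by
  ext n
  induction n generalizing a b with
  | zero => simp [formalFlow]
  | succ n ih =>
    have h : ((n : ℂ) + 1) ≠ 0 := Nat.cast_add_one_ne_zero n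
    apply mul_right_cancel₀ h
    rw [← PowerSeries.coeff_derivative, ← PowerSeries.coeff_derivative, derivative_formalFlow,
      Derivation.leibniz, Derivation.leibniz, derivative_formalFlow, derivative_formalFlow]
    simp only [smul_eq_mul, map_add, ih]

lemma formalFlow_one (ξ : Derivation ℂ A A) (p : A →ₐ[ℂ] ℂ) : formalFlow ξ p 1 = 1 := by
  ext n
  cases n with
  | zero => simp [formalFlow]
  | succ n => simp [formalFlow, pow_succ, PowerSeries.coeff_one]

open Polynomial in
/-- The orbit map of a locally nilpotent derivation through a point is polynomial. -/
lemma IsLND.exists_orbit {ξ : Derivation ℂ A A} (hξ : IsLND ξ) (p : A →ₐ[ℂ] ℂ) :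
    ∃ Q : A →ₐ[ℂ] ℂ[X], (∀ a, derivative (Q a) = Q (ξ a)) ∧ ∀ a, (Q a).eval 0 = p a := by
  have hpoly (a : A) : ∃ P : ℂ[X], (P : PowerSeries ℂ) = formalFlow ξ p a := by
    obtain ⟨N, hN⟩ := hξ a
    refine ⟨PowerSeries.trunc N (formalFlow ξ p a), ?_⟩
    ext n
    rw [Polynomial.coeff_coe, PowerSeries.coeff_trunc]
    split_ifs with h
    · rfl
    · simp [formalFlow, Derivation.pow_apply_eq_zero_of_le (not_lt.mp h) hN]
  choose P hP using hpoly
  refine ⟨AlgHom.ofLinearMap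
    { toFun := P
      map_add' := fun a b => Polynomial.coe_injective ℂ (by simp [hP])
      map_smul' := fun c a => Polynomial.coe_injective ℂ (by
        simp [hP, Polynomial.coe_smul]) }
    (Polynomial.coe_injective ℂ (by simp [hP, formalFlow_one]))
    (fun a b => Polynomial.coe_injective ℂ (by simp [hP, formalFlow_mul])), ?_, ?_⟩
  · intro a
    apply Polynomial.coe_injective ℂ
    change ((derivative (P a) : ℂ[X]) : PowerSeries ℂ) = (P (ξ a) : PowerSeries ℂ)
    rw [hP, ← derivative_formalFlow, ← hP]
    exact (PowerSeries.derivative_coe _).symm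
  · intro a
    change (P a).eval 0 = _
    rw [← Polynomial.coeff_zero_eq_eval_zero, ← Polynomial.coeff_coe, hP]
    simp [formalFlow]

open Polynomial in
/-- If `ξ` is locally nilpotent and `ξ (ξ g) = 0` then `g ξ` is complete. -/
lemma IsLND.isCompleteField_smul {ξ : Derivation ℂ A A} (hξ : IsLND ξ) {g : A}
    (hg : ξ (ξ g) = 0) : IsCompleteField (g • ξ) := by
  intro p
  obtain ⟨Q, hQ, hQ0⟩ := hξ.exists_orbit p
  have hlin : ∃ c₀ c₁ : ℂ, ∀ s, (Q g).eval s = c₀ + c₁ * s := by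
    have h1 : derivative (Q (ξ g)) = 0 := by rw [hQ, hg, map_zero]
    have h2 := eq_C_of_natDegree_eq_zero (derivative_eq_zero.mp h1)
    set c := (Q (ξ g)).coeff 0
    have h3 : derivative (Q g - C c * X) = 0 := by
      rw [derivative_sub, hQ, h2]; simp
    have h4 := eq_C_of_natDegree_eq_zero (derivative_eq_zero.mp h3)
    refine ⟨(Q g - C c * X).coeff 0, c, fun s => ?_⟩
    rw [sub_eq_iff_eq_add] at h4
    have := congrArg (Polynomial.eval s) h4
    simpa using this
  obtain ⟨c₀, c₁, hc⟩ := hlin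
  have htime : ∃ σ : ℂ → ℂ, σ 0 = 0 ∧ ∀ t, HasDerivAt σ (c₀ + c₁ * σ t) t := by
    by_cases h : c₁ = 0
    · refine ⟨fun t => c₀ * t, by simp, fun t => ?_⟩
      simpa [h] using (hasDerivAt_id t).const_mul c₀
    · refine ⟨fun t => c₀ / c₁ * (Complex.exp (c₁ * t) - 1), by simp, fun t => ?_⟩
      refine (((((hasDerivAt_id t).const_mul c₁).cexp).sub_const 1).const_mul
        (c₀ / c₁)).congr_deriv ?_
      simp only [id]
      field_simp
      ring
  obtain ⟨σ, hσ0, hσ⟩ := htime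
  refine ⟨fun t => (aeval (σ t)).comp Q, ?_, fun a t => ?_⟩
  · ext a
    simp [hσ0, ← hQ0]
  · have h := ((Q a).hasDerivAt (σ t)).comp t (hσ t)
    rw [hQ, ← hc] at h
    simp only [AlgHom.comp_apply, Polynomial.coe_aeval_eq_eval, Derivation.smul_apply,
      smul_eq_mul, map_mul, Function.comp_def] at h ⊢
    rwa [mul_comm]

lemma IsLND.smul_mem_lieAlgGen {ξ : Derivation ℂ A A} (hξ : IsLND ξ) {g : A}
    (hg : ξ (ξ g) = 0) : g • ξ ∈ LieAlgGen A :=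
  LieSubalgebra.subset_lieSpan (hξ.isCompleteField_smul hg)

/-- The compatible-pair identity
`[f ξ, a g η] - [a f ξ, g η] = f g ξ(a) η` for `f, ξ a ∈ Ker ξ` and `g, a ∈ Ker η`. -/
lemma mul_smul_mem_lieAlgGen {ξ η : Derivation ℂ A A} (hξ : IsLND ξ) (hη : IsLND η) {f g a : A}
    (hf : ξ f = 0) (hξa : ξ (ξ a) = 0) (hg : η g = 0) (ha : η a = 0) :
    (f * g * ξ a) • η ∈ LieAlgGen A := by
  have h1 : f • ξ ∈ LieAlgGen A := hξ.smul_mem_lieAlgGen (by simp [hf])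
  have h2 : (a * f) • ξ ∈ LieAlgGen A := hξ.smul_mem_lieAlgGen (by simp [hf, hξa])
  have h3 : g • η ∈ LieAlgGen A := hη.smul_mem_lieAlgGen (by simp [hg])
  have h4 : (a * g) • η ∈ LieAlgGen A := hη.smul_mem_lieAlgGen (by simp [hg, ha])
  have h := sub_mem (LieSubalgebra.lie_mem _ h1 h4) (LieSubalgebra.lie_mem _ h2 h3)
  convert h using 1
  ext x
  simp only [Derivation.smul_apply, Derivation.sub_apply, Derivation.commutator_apply,
    Derivation.leibniz, smul_eq_mul, ha]
  ring

lemma Derivation.pow_apply_mul_of_mem_ker {ξ : Derivation ℂ A A} {c : A} (hc : ξ c = 0) (n : ℕ)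
    (x : A) : (ξ.toLinearMap ^ n) (c * x) = c * (ξ.toLinearMap ^ n) x := by
  induction n generalizing x with
  | zero => simp
  | succ n ih => simp [pow_succ, hc, ih]

lemma Derivation.pow_apply_pow_mul {ξ : Derivation ℂ A A} {s g : A} (hs : ξ (ξ s) = 0)
    (hg : ξ g = 0) (n : ℕ) :
    (ξ.toLinearMap ^ n) (s ^ n * g) = n.factorial * (ξ s) ^ n * g := by
  induction n with
  | zero => simp
  | succ n ih =>
    have : ξ (s ^ (n + 1) * g) = ((n + 1 : ℕ) * ξ s) * (s ^ n * g) := by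
      simp [hg, Derivation.leibniz_pow]; ring
    have hc : ξ ((n + 1 : ℕ) * ξ s) = 0 := by
      rw [Derivation.leibniz, hs, Derivation.map_natCast]; simp
    rw [pow_succ, Module.End.mul_apply, Derivation.coeFn_coe, this,
      Derivation.pow_apply_mul_of_mem_ker hc, ih, Nat.factorial_succ]
    push_cast; ring

/-- Up to a power of `ξ s`, every element killed by a power of `ξ` is a polynomial in `s`
with coefficients in `Ker ξ`. -/
lemma exists_pow_mul_mem_of_pow_apply_eq_zero {ξ : Derivation ℂ A A} {s : A} (hs : ξ (ξ s) = 0)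
    {S : Submodule ℂ A} (hS : ∀ g n, ξ g = 0 → s ^ n * g ∈ S) (N : ℕ) (f : A)
    (hf : (ξ.toLinearMap ^ N) f = 0) : ∃ M, ∀ m, M ≤ m → (ξ s) ^ m * f ∈ S := by
  induction N generalizing f with
  | zero =>
    have : f = 0 := by simpa using hf
    exact ⟨0, fun m _ => by simp [this]⟩
  | succ N ih =>
    set g := (ξ.toLinearMap ^ N) f with hgdef
    have hg : ξ g = 0 := by
      rw [pow_succ'] at hf; exact hf
    have hfac : (N.factorial : ℂ) ≠ 0 := by exact_mod_cast N.factorial_ne_zero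
    have hpow (n : ℕ) : ξ (ξ s ^ n) = 0 := by simp [Derivation.leibniz_pow, hs]
    obtain ⟨M, hM⟩ := ih ((N.factorial : A) * ξ s ^ N * f - s ^ N * g) (by
      rw [map_sub, Derivation.pow_apply_pow_mul hs hg, Derivation.pow_apply_mul_of_mem_ker
        (by simp [hpow]), sub_self])
    refine ⟨M + N, fun m hm => ?_⟩
    obtain ⟨k, rfl⟩ := Nat.exists_eq_add_of_le hm
    have h1 := hM (M + k) (by omega)
    have h2 := hS (ξ s ^ (M + k) * g) N (by simp [hg, hpow])
    have h3 := S.smul_mem (N.factorial : ℂ)⁻¹ (S.add_mem h1 h2)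
    convert h3 using 1
    rw [eq_inv_smul_iff₀ hfac, Algebra.smul_def, map_natCast]
    ring

end LocallyNilpotent

section TensorProduct

variable (S : Type*) {Y : Type*} [CommRing S] [Algebra ℂ S] [CommRing Y] [Algebra ℂ Y]

/-- The derivation `id ⊗ δ` of `S ⊗ Y`. -/
def Derivation.lTensor (δ : Derivation ℂ Y Y) : Derivation ℂ (S ⊗[ℂ] Y) (S ⊗[ℂ] Y) :=
  Derivation.mk' (LinearMap.lTensor S δ.toLinearMap) fun a b => by
    induction a with
    | zero => simp
    | add a₁ a₂ h₁ h₂ => rw [add_mul, map_add, h₁, h₂, map_add, add_smul, smul_add]; abel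
    | tmul s y =>
      induction b with
      | zero => simp
      | add b₁ b₂ h₁ h₂ => rw [mul_add, map_add, h₁, h₂, map_add, add_smul, smul_add]; abel
      | tmul t z =>
        simp [Algebra.TensorProduct.tmul_mul_tmul, TensorProduct.tmul_add, mul_comm]

lemma Derivation.lTensor_tmul (δ : Derivation ℂ Y Y) (s : S) (y : Y) :
    δ.lTensor S (s ⊗ₜ y) = s ⊗ₜ δ y := rfl

lemma IsLND.lTensor {δ : Derivation ℂ Y Y} (hδ : IsLND δ) : IsLND (δ.lTensor S) := by
  intro x
  induction x with
  | zero => exact ⟨0, by simp⟩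
  | add a b ha hb =>
    obtain ⟨m, hm⟩ := ha
    obtain ⟨n, hn⟩ := hb
    refine ⟨max m n, ?_⟩
    rw [map_add, Derivation.pow_apply_eq_zero_of_le (le_max_left m n) hm,
      Derivation.pow_apply_eq_zero_of_le (le_max_right m n) hn, add_zero]
  | tmul s y =>
    have key (n : ℕ) :
        ((δ.lTensor S).toLinearMap ^ n) (s ⊗ₜ y) = s ⊗ₜ ((δ.toLinearMap ^ n) y) := by
      induction n with
      | zero => rfl
      | succ n ih =>
        simp only [pow_succ', Module.End.mul_apply, ih, Derivation.coeFn_coe,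
          Derivation.lTensor_tmul]
    obtain ⟨N, hN⟩ := hδ y
    exact ⟨N, by rw [key, hN, TensorProduct.tmul_zero]⟩

lemma Derivation.lTensor_ne_zero [Nontrivial S] {δ : Derivation ℂ Y Y} (hδ : δ ≠ 0) :
    δ.lTensor S ≠ 0 := by
  intro h
  refine hδ (Derivation.ext fun y => ?_)
  have h1 : (1 : S) ⊗ₜ[ℂ] δ y = 1 ⊗ₜ[ℂ] 0 := by
    rw [← Derivation.lTensor_tmul, h, TensorProduct.tmul_zero]; rfl
  exact Algebra.TensorProduct.includeRight_injective (algebraMap ℂ S).injective h1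

end TensorProduct

section Transport

variable {S T : Type*} [CommRing S] [Algebra ℂ S] [CommRing T] [Algebra ℂ T]

/-- Transport of a derivation along an algebra isomorphism. -/
def Derivation.transport (e : S ≃ₐ[ℂ] T) (D : Derivation ℂ T T) : Derivation ℂ S S :=
  Derivation.mk' (e.symm.toLinearMap ∘ₗ D.toLinearMap ∘ₗ e.toLinearMap) fun a b => by simp

lemma Derivation.transport_apply (e : S ≃ₐ[ℂ] T) (D : Derivation ℂ T T) (a : S) :
    D.transport e a = e.symm (D (e a)) := rfl

lemma IsLND.transport {D : Derivation ℂ T T} (hD : IsLND D) (e : S ≃ₐ[ℂ] T) :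
    IsLND (D.transport e) := by
  intro a
  obtain ⟨N, hN⟩ := hD (e a)
  have key (n : ℕ) :
      ((D.transport e).toLinearMap ^ n) a = e.symm ((D.toLinearMap ^ n) (e a)) := by
    induction n with
    | zero => simp
    | succ n ih =>
      simp only [pow_succ', Module.End.mul_apply, ih, Derivation.coeFn_coe,
        Derivation.transport_apply, AlgEquiv.apply_symm_apply]
  exact ⟨N, by rw [key, hN, map_zero]⟩

lemma Derivation.transport_ne_zero (e : S ≃ₐ[ℂ] T) {D : Derivation ℂ T T} (hD : D ≠ 0) :
    D.transport e ≠ 0 := by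
  intro h
  refine hD (Derivation.ext fun x => e.symm.injective ?_)
  have := Derivation.congr_fun h (e.symm x)
  simpa [Derivation.transport_apply] using this

end Transport

section Localization

variable {A S : Type*} [CommRing A] [Algebra ℂ A] [CommRing S] [Algebra ℂ S]
  [Algebra A S] [IsScalarTower ℂ A S]

/-- A derivation of a localization of a finitely generated algebra has, after multiplication
by a power of the denominator, integral values on the algebra. -/
lemma exists_pow_mul_derivation_mem_range (hA : Algebra.FiniteType ℂ A) (x : A)
    [IsLocalization.Away x S] (D : Derivation ℂ S S) :
    ∃ N : ℕ, ∀ a : A, ∃ b : A,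
      algebraMap A S b = algebraMap A S x ^ N * D (algebraMap A S a) := by
  obtain ⟨G, hG⟩ := hA.out
  have hgen (a : A) : ∃ n : ℕ, ∃ b : A,
      algebraMap A S b = algebraMap A S x ^ n * D (algebraMap A S a) := by
    obtain ⟨n, b, h⟩ := IsLocalization.Away.surj x (D (algebraMap A S a))
    exact ⟨n, b, by rw [← h, mul_comm]⟩
  choose n hn using hgen
  refine ⟨G.sup n, fun a => ?_⟩
  have ha : a ∈ Algebra.adjoin ℂ (G : Set A) := hG ▸ Algebra.mem_top
  induction ha using Algebra.adjoin_induction with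
  | mem g hg =>
    obtain ⟨b, hb⟩ := hn g
    refine ⟨x ^ (G.sup n - n g) * b, ?_⟩
    rw [map_mul, map_pow, hb, ← mul_assoc, ← pow_add,
      Nat.sub_add_cancel (Finset.le_sup (f := n) hg)]
  | algebraMap c =>
    refine ⟨0, ?_⟩
    rw [← IsScalarTower.algebraMap_apply, Derivation.map_algebraMap]; simp
  | add a b _ _ ha hb =>
    obtain ⟨a', ha'⟩ := ha
    obtain ⟨b', hb'⟩ := hb
    exact ⟨a' + b', by rw [map_add, map_add, map_add, ha', hb', mul_add]⟩
  | mul a b _ _ ha hb =>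
    obtain ⟨a', ha'⟩ := ha
    obtain ⟨b', hb'⟩ := hb
    refine ⟨a * b' + b * a', ?_⟩
    simp only [map_add, map_mul, ha', hb', Derivation.leibniz, smul_eq_mul]
    ring

/-- Clearing denominators in a locally nilpotent derivation of a localization. -/
lemma IsLND.exists_of_away [IsDomain A] (hA : Algebra.FiniteType ℂ A) {x : A} (hx : x ≠ 0)
    [IsLocalization.Away x S] {D : Derivation ℂ S S} (hD : IsLND D) (hD0 : D ≠ 0)
    (hDx : D (algebraMap A S x) = 0) :
    ∃ η : Derivation ℂ A A, IsLND η ∧ η ≠ 0 ∧ ∀ a, D (algebraMap A S a) = 0 → η a = 0 := by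
  have hinj : Function.Injective (algebraMap A S) :=
    IsLocalization.injective S (powers_le_nonZeroDivisors_of_noZeroDivisors hx)
  obtain ⟨N, hN⟩ := exists_pow_mul_derivation_mem_range (S := S) hA x D
  choose f hf using hN
  have hxN : D (algebraMap A S x ^ N) = 0 := by simp [Derivation.leibniz_pow, hDx]
  let η : Derivation ℂ A A := Derivation.mk'
    { toFun := f
      map_add' := fun a b => hinj (by simp only [hf, map_add, mul_add])
      map_smul' := fun c a => hinj (by
        simp only [hf, algebraMap.coe_smul, Derivation.map_smul, RingHom.id_apply,
          mul_smul_comm]) }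
    fun a b => hinj (by
      simp only [LinearMap.coe_mk, AddHom.coe_mk, hf, map_add, map_mul, smul_eq_mul,
        Derivation.leibniz]
      ring)
  have hη (a : A) : algebraMap A S (η a) = algebraMap A S x ^ N * D (algebraMap A S a) := hf a
  refine ⟨η, fun a => ?_, fun h0 => hD0 (Derivation.ext fun y => ?_), fun a ha => hinj ?_⟩
  · have key (n : ℕ) : algebraMap A S ((η.toLinearMap ^ n) a) =
        (algebraMap A S x ^ N) ^ n * (D.toLinearMap ^ n) (algebraMap A S a) := by
      induction n with
      | zero => simp
      | succ n ih =>
        simp only [pow_succ' _ n, Module.End.mul_apply, Derivation.coeFn_coe, hη, ih]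
        simp [Derivation.leibniz_pow, hxN, mul_assoc]
    obtain ⟨M, hM⟩ := hD (algebraMap A S a)
    exact ⟨M, hinj (by rw [key, hM, mul_zero, map_zero])⟩
  · have hu : IsUnit (algebraMap A S x) := IsLocalization.Away.algebraMap_isUnit x
    obtain ⟨n, a, h⟩ := IsLocalization.Away.surj x y
    have h1 := hη a
    rw [h0, Derivation.zero_apply, map_zero, ← h, Derivation.leibniz, Derivation.leibniz_pow,
      hDx, smul_zero, smul_zero, smul_zero, zero_add, smul_eq_mul, eq_comm, ← mul_assoc] at h1
    simpa using ((hu.pow N).mul (hu.pow n)).mul_right_eq_zero.mp h1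
  · rw [hη, ha, mul_zero, map_zero]

end Localization

/-- Weak Nullstellensatz: functions without common zeros generate the unit ideal, and so do
arbitrary powers of them. -/
lemma Ideal.span_pow_eq_top_of_no_common_zero {R ι : Type*} [CommRing R] [Algebra ℂ R]
    (hR : Algebra.FiniteType ℂ R) (α : ι → R) (hα : ¬ ∃ q : R →ₐ[ℂ] ℂ, ∀ i, q (α i) = 0)
    (n : ι → ℕ) : Ideal.span (Set.range fun i => α i ^ n i) = ⊤ := by
  by_contra h
  obtain ⟨m, hm, hle⟩ := Ideal.exists_le_maximal _ h
  let : Field (R ⧸ m) := Ideal.Quotient.field m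
  have : Algebra.FiniteType ℂ (R ⧸ m) := inferInstance
  have : Module.Finite ℂ (R ⧸ m) := finite_of_finite_type_of_isJacobsonRing ℂ (R ⧸ m)
  let e : ℂ ≃ₐ[ℂ] (R ⧸ m) := AlgEquiv.ofBijective (Algebra.ofId ℂ (R ⧸ m))
    (IsAlgClosed.algebraMap_bijective_of_isIntegral (k := ℂ) (K := R ⧸ m))
  refine hα ⟨e.symm.toAlgHom.comp (Ideal.Quotient.mkₐ ℂ m), fun i => ?_⟩
  have : α i ∈ m := hm.isPrime.mem_of_pow_mem (n i) (hle (Ideal.subset_span ⟨i, rfl⟩))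
  have h0 : Ideal.Quotient.mkₐ ℂ m (α i) = 0 := Ideal.Quotient.eq_zero_iff_mem.mpr this
  rw [AlgHom.comp_apply, h0, map_zero]

/-- A fibration whose fibre carries a nontrivial locally nilpotent derivation carries a
nontrivial vertical one. -/
lemma exists_vertical_isLND {A R Y : Type*} [CommRing A] [IsDomain A] [Algebra ℂ A]
    [CommRing R] [IsDomain R] [Algebra ℂ R] [CommRing Y] [Nontrivial Y] [Algebra ℂ Y]
    (hA : Algebra.FiniteType ℂ A) (φ : R →ₐ[ℂ] A) {δ : Derivation ℂ Y Y} (hδ : IsLND δ)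
    (hδ0 : δ ≠ 0) {x : R} (hx : x ≠ 0)
    (e : Localization.Away (φ x) ≃+* (Localization.Away x ⊗[ℂ] Y))
    (he : ∀ r : R, e (algebraMap A (Localization.Away (φ x)) (φ r)) =
      (algebraMap R (Localization.Away x) r) ⊗ₜ[ℂ] 1) :
    ∃ η : Derivation ℂ A A, IsLND η ∧ η ≠ 0 ∧ ∀ r, η (φ r) = 0 := by
  have hnt : Nontrivial (Localization.Away x) :=
    (IsLocalization.injective (Localization.Away x)
      (powers_le_nonZeroDivisors_of_noZeroDivisors hx)).nontrivial
  have hnt' : Nontrivial (Localization.Away x ⊗[ℂ] Y) :=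
    (Algebra.TensorProduct.includeRight_injective (R := ℂ) (A := Localization.Away x) (B := Y)
      (algebraMap ℂ _).injective).nontrivial
  have hφx : φ x ≠ 0 := by
    intro h
    have h1 : IsUnit (algebraMap A (Localization.Away (φ x)) (φ x)) :=
      IsLocalization.Away.algebraMap_isUnit (φ x)
    have h2 := h1.map e
    rw [(congrArg (algebraMap A _) h).trans (map_zero _), map_zero] at h2
    exact not_isUnit_zero h2
  let e' : Localization.Away (φ x) ≃ₐ[ℂ] (Localization.Away x ⊗[ℂ] Y) :=
    AlgEquiv.ofRingEquiv (f := e) fun c => by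
      rw [IsScalarTower.algebraMap_apply ℂ A, ← φ.commutes, he,
        ← IsScalarTower.algebraMap_apply, Algebra.TensorProduct.algebraMap_apply]
  have hD (r : R) : (δ.lTensor (Localization.Away x)).transport e'
      (algebraMap A (Localization.Away (φ x)) (φ r)) = 0 := by
    rw [Derivation.transport_apply]
    change e'.symm (δ.lTensor _ (e _)) = 0
    rw [he, Derivation.lTensor_tmul, Derivation.map_one_eq_zero, TensorProduct.tmul_zero,
      map_zero]
  obtain ⟨η, h1, h2, h3⟩ := IsLND.exists_of_away hA hφx
    ((hδ.lTensor (Localization.Away x)).transport e')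
    (Derivation.transport_ne_zero e' (Derivation.lTensor_ne_zero _ hδ0)) (hD x)
  exact ⟨η, h1, h2, fun r => h3 _ (hD r)⟩

/-- A locally nilpotent derivation lifting one with a slice away from `x` forces `f η`, multiplied
by a power of `x`, into the Lie algebra generated by complete fields. -/
lemma exists_pow_smul_mem_lieAlgGen {A R : Type*} [CommRing A] [Algebra ℂ A]
    [CommRing R] [Algebra ℂ R] (φ : R →ₐ[ℂ] A) {ξ η : Derivation ℂ A A} (hξ : IsLND ξ)
    (hη : IsLND η) (hηφ : ∀ r, η (φ r) = 0) {x r : R} {m : ℕ} (hr : ξ (φ r) = φ (x ^ m))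
    (hx : ξ (φ x) = 0) (f : A) :
    ∃ n : ℕ, ∀ b : R, (φ (b * x ^ n) * f) • η ∈ LieAlgGen A := by
  have hs : ξ (ξ (φ r)) = 0 := by
    rw [hr, map_pow, Derivation.leibniz_pow, hx]; simp
  let S : Submodule ℂ A :=
    { carrier := {y | ∀ b : R, (y * φ b * ξ (φ r)) • η ∈ LieAlgGen A}
      add_mem' := fun {y z} hy hz b => by
        rw [add_mul, add_mul, add_smul]; exact add_mem (hy b) (hz b)
      zero_mem' := fun b => by simp
      smul_mem' := fun c y hy b => by
        rw [smul_mul_assoc, smul_mul_assoc, smul_assoc]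
        exact (LieAlgGen A).smul_mem c (hy b) }
  obtain ⟨N, hN⟩ := hξ f
  obtain ⟨M, hM⟩ := exists_pow_mul_mem_of_pow_apply_eq_zero (S := S) hs (fun g n hg b => by
    rw [mul_comm (φ r ^ n) g, mul_assoc g]
    exact mul_smul_mem_lieAlgGen hξ hη hg hs
      (by rw [← map_pow, ← map_mul, hηφ]) (hηφ r)) N f hN
  refine ⟨m * (M + 1), fun b => ?_⟩
  convert hM M le_rfl b using 2
  rw [hr, pow_mul, map_mul, map_pow φ (x ^ m)]
  ring

theorem statement13 (A R CY : Type) [CommRing A] [IsDomain A] [Algebra ℂ A]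
    [CommRing R] [IsDomain R] [Algebra ℂ R] [CommRing CY] [IsDomain CY] [Algebra ℂ CY]
    (hfgA : Algebra.FiniteType ℂ A) (hsmA : Algebra.FormallySmooth ℂ A)
    (hfgR : Algebra.FiniteType ℂ R) (hsmR : Algebra.FormallySmooth ℂ R)
    (hfgY : Algebra.FiniteType ℂ CY)
    (πs : R →ₐ[ℂ] A)
    -- the fiber Y admits a nontrivial locally nilpotent vector field δ
    (δ : Derivation ℂ CY CY) (hδ : IsLND δ) (hδ0 : δ ≠ 0)
    (k : ℕ) (α : Fin k → R)
    (hnocommonzero : ¬ ∃ q : R →ₐ[ℂ] ℂ, ∀ i, q (α i) = 0)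
    -- local triviality: X_i ≅ B_i × Y over B_i
    (htriv : ∀ i, ∃ e : Localization.Away (πs (α i)) ≃+*
        (Localization.Away (α i) ⊗[ℂ] CY),
      ∀ r : R, e (algebraMap A (Localization.Away (πs (α i))) (πs r)) =
        (algebraMap R (Localization.Away (α i)) r) ⊗ₜ[ℂ] 1)
    (ξ : Fin k → Derivation ℂ A A) (hξLND : ∀ i, IsLND (ξ i))
    -- (i) ξ_i preserves ℂ[B] and induces ξ_i′ there
    (ξ' : Fin k → Derivation ℂ R R)
    (hinduce : ∀ i (r : R), ξ i (πs r) = πs (ξ' i r))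
    -- (ii) α_i ∈ Ker ξ_i′
    (hα : ∀ i, ξ' i (α i) = 0)
    -- (iii) ξ_i′ admits a slice on B_i (an s = r/α_i^m with ξ_i′ s = 1)
    (hslice : ∀ i, ∃ (r : R) (m : ℕ), ξ' i r = α i ^ m ∧ α i ^ m ≠ 0) :
    ∃ (η : Derivation ℂ A A) (J : Ideal A), IsLND η ∧ η ≠ 0 ∧ J ≠ ⊥ ∧
      ∀ f ∈ J, (f • η : Derivation ℂ A A) ∈ LieAlgGen A := by
  obtain ⟨i, hi⟩ : ∃ i, α i ≠ 0 := by
    by_contra! h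
    have h1 := Ideal.span_pow_eq_top_of_no_common_zero hfgR α hnocommonzero fun _ => 1
    refine bot_ne_top (α := Ideal R) (h1 ▸ (Ideal.span_eq_bot.mpr ?_).symm)
    rintro _ ⟨i, rfl⟩
    simp [h i]
  obtain ⟨e, he⟩ := htriv i
  obtain ⟨η, hη, hη0, hηπ⟩ := exists_vertical_isLND hfgA πs hδ hδ0 hi e he
  refine ⟨η, ⊤, hη, hη0, top_ne_bot, fun f _ => ?_⟩
  have hpow (j : Fin k) : ∃ n : ℕ, ∀ b : R, (πs (b * α j ^ n) * f) • η ∈ LieAlgGen A := by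
    obtain ⟨r, m, hr, -⟩ := hslice j
    exact exists_pow_smul_mem_lieAlgGen πs (hξLND j) hη hηπ (by rw [hinduce, hr])
      (by rw [hinduce, hα, map_zero]) f
  choose n hn using hpow
  obtain ⟨c, hc⟩ := Ideal.mem_span_range_iff_exists_fun.mp
    ((Ideal.eq_top_iff_one _).mp
      (Ideal.span_pow_eq_top_of_no_common_zero hfgR α hnocommonzero n))
  have hf : f • η = ∑ j, (πs (c j * α j ^ n j) * f) • η := by
    rw [← Finset.sum_smul, ← Finset.sum_mul, ← map_sum, hc, map_one, one_mul]
  rw [hf]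
  exact sum_mem fun j _ => hn j (c j)
end
end
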